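/- arXiv:math/0311032 — 7 statements merged into one kernel-verified Lean document; each statement's English description precedes it below -/
import Mathlib

section
/- Let T ∈ (0, ∞) and let X : [0,T) → ℝ^d be differentiable with X(0) = x₀ and X'(t) = b(X(t)) for all t ∈ [0,T). Then sup_{t ∈ [0,T)} |X(t)| < ∞. Consequently, every maximal solution of the ODE X'(t) = b(X(t)), X(0) = x₀ is defined on all of [0, ∞) (the lifetime is infinite). -/
open Set Filter MeasureTheory

open scoped Topology

section Peano

variable {E : Type*} [NormedAddCommGroup E] [NormedSpace ℝ E]

/-- The explicit Euler scheme with step `h` for the autonomous equation `x' = b x`. -/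
noncomputable def eulerSeq (b : E → E) (h : ℝ) (x₀ : E) : ℕ → E
  | 0 => x₀
  | k + 1 => eulerSeq b h x₀ k + h • b (eulerSeq b h x₀ k)

theorem norm_eulerSeq_sub_sub_smul_le {b : E → E} {h : ℝ} (hh : 0 ≤ h) {x₀ v : E} {ε : ℝ}
    {i j : ℕ} (hij : i ≤ j)
    (hv : ∀ k, i ≤ k → k < j → ‖b (eulerSeq b h x₀ k) - v‖ ≤ ε) :
    ‖eulerSeq b h x₀ j - eulerSeq b h x₀ i - (((j : ℝ) - i) * h) • v‖
      ≤ ε * (((j : ℝ) - i) * h) := by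
  induction j, hij using Nat.le_induction with
  | base => simp
  | succ j hij ih =>
    have h₁ := ih fun k hk hkj => hv k hk (hkj.trans (Nat.lt_succ_self j))
    have h₂ := hv j hij (Nat.lt_succ_self j)
    have heq : eulerSeq b h x₀ (j + 1) - eulerSeq b h x₀ i - ((((j + 1 : ℕ) : ℝ) - i) * h) • v
        = (eulerSeq b h x₀ j - eulerSeq b h x₀ i - (((j : ℝ) - i) * h) • v)
          + h • (b (eulerSeq b h x₀ j) - v) := by
      simp only [eulerSeq]
      push_cast
      module
    rw [heq]
    refine (norm_add_le _ _).trans ?_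
    rw [norm_smul, Real.norm_of_nonneg hh]
    push_cast
    nlinarith [mul_le_mul_of_nonneg_left h₂ hh]

theorem norm_eulerSeq_sub_le {b : E → E} {B : ℝ} (hB : ∀ x, ‖b x‖ ≤ B) {h : ℝ} (hh : 0 ≤ h)
    (x₀ : E) {i j : ℕ} (hij : i ≤ j) :
    ‖eulerSeq b h x₀ j - eulerSeq b h x₀ i‖ ≤ B * (((j : ℝ) - i) * h) := by
  simpa using norm_eulerSeq_sub_sub_smul_le (b := b) (x₀ := x₀) (v := 0) (ε := B) hh hij
    fun k _ _ => by simpa using hB _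

/-- **Peano's existence theorem** for a bounded continuous autonomous vector field. -/
theorem exists_hasDerivWithinAt_Ici_of_bounded [ProperSpace E] {b : E → E} (hb : Continuous b)
    {B : ℝ} (hB : ∀ x, ‖b x‖ ≤ B) (x₀ : E) :
    ∃ Y : ℝ → E, Y 0 = x₀ ∧ ∀ t ∈ Ici (0 : ℝ), HasDerivWithinAt Y (b (Y t)) (Ici 0) t := by
  have hB0 : 0 ≤ B := (norm_nonneg _).trans (hB x₀)
  let N : ℕ → ℝ → ℕ := fun n t => ⌊t * n⌋₊
  let x : ℕ → ℕ → E := fun n => eulerSeq b (1 / (n : ℝ)) x₀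
  let U : Ultrafilter ℕ := hyperfilter ℕ
  have hU : (U : Filter ℕ) ≤ atTop := Nat.hyperfilter_le_atTop
  have hstep : ∀ n : ℕ, (0 : ℝ) ≤ 1 / (n : ℝ) := fun n => by positivity
  have hNmono : ∀ n, Monotone (N n) := fun n s t hst =>
    Nat.floor_le_floor (mul_le_mul_of_nonneg_right hst n.cast_nonneg)
  have hN : ∀ t, 0 ≤ t → Tendsto (fun n : ℕ => (N n t : ℝ) * (1 / (n : ℝ))) U (𝓝 t) := by
    intro t ht
    refine Tendsto.mono_left ?_ hU
    have := (tendsto_nat_floor_mul_div_atTop ht).comp (tendsto_natCast_atTop_atTop (R := ℝ))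
    refine this.congr fun n => ?_
    simp [N, div_eq_mul_inv]
  have hNsub : ∀ s t, 0 ≤ s → 0 ≤ t → Tendsto
      (fun n : ℕ => ((N n t : ℝ) - N n s) * (1 / (n : ℝ))) U (𝓝 (t - s)) := by
    intro s t hs ht
    refine ((hN t ht).sub (hN s hs)).congr fun n => ?_
    ring
  have hlim : ∀ t, 0 ≤ t → ∃ y, Tendsto (fun n => x n (N n t)) U (𝓝 y) := by
    intro t ht
    have hball : ∀ n, x n (N n t) ∈ Metric.closedBall x₀ (B * t) := by
      intro n
      rw [mem_closedBall_iff_norm]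
      refine (norm_eulerSeq_sub_le hB (hstep n) x₀ (Nat.zero_le _)).trans ?_
      refine mul_le_mul_of_nonneg_left ?_ hB0
      rw [Nat.cast_zero, sub_zero, mul_one_div]
      exact div_le_of_le_mul₀ n.cast_nonneg ht (Nat.floor_le (by positivity))
    obtain ⟨y, -, hy⟩ := (isCompact_closedBall x₀ (B * t)).ultrafilter_le_nhds
      (U.map fun n => x n (N n t)) (by
        rw [le_principal_iff]
        exact Filter.mem_map.2 (Filter.univ_mem' hball))
    exact ⟨y, hy⟩
  choose! Y hY using hlim
  have key : ∀ s t p ε δ : ℝ, 0 ≤ s → s ≤ p → p ≤ t → B * (t - s) < δ →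
      (∀ y, ‖y - Y p‖ < 2 * δ → ‖b y - b (Y p)‖ ≤ ε) →
      ‖Y t - Y s - (t - s) • b (Y p)‖ ≤ ε * (t - s) := by
    intro s t p ε δ hs hsp hpt hδ hε
    have hp := hs.trans hsp
    have ht := hp.trans hpt
    have hδ0 : 0 < δ := lt_of_le_of_lt (mul_nonneg hB0 (by linarith)) hδ
    refine le_of_tendsto_of_tendsto
      ((((hY t ht).sub (hY s hs)).sub ((hNsub s t hs ht).smul_const (b (Y p)))).norm)
      ((hNsub s t hs ht).const_mul ε) ?_
    have h₁ : ∀ᶠ n in (U : Filter ℕ), ‖x n (N n p) - Y p‖ < δ :=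
      ((tendsto_iff_norm_sub_tendsto_zero.1 (hY p hp)).eventually_lt_const hδ0)
    have h₂ := ((hNsub s t hs ht).const_mul B).eventually_lt_const hδ
    filter_upwards [h₁, h₂] with n h₁ h₂
    refine norm_eulerSeq_sub_sub_smul_le (hstep n) (hNmono n (hsp.trans hpt)) fun k hk hkt =>
      hε _ ?_
    have h₃ : ‖x n k - x n (N n p)‖ ≤ B * (((N n t : ℝ) - N n s) * (1 / (n : ℝ))) := by
      have hkt' : (k : ℝ) ≤ N n t := by exact_mod_cast hkt.le
      have hk' : (N n s : ℝ) ≤ k := by exact_mod_cast hk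
      have hp₁ : (N n s : ℝ) ≤ N n p := by exact_mod_cast hNmono n hsp
      have hp₂ : (N n p : ℝ) ≤ N n t := by exact_mod_cast hNmono n hpt
      rcases le_total k (N n p) with hkp | hkp
      · rw [norm_sub_rev]
        refine (norm_eulerSeq_sub_le hB (hstep n) x₀ hkp).trans ?_
        gcongr
      · refine (norm_eulerSeq_sub_le hB (hstep n) x₀ hkp).trans ?_
        gcongr
    calc ‖x n k - Y p‖ = ‖(x n k - x n (N n p)) + (x n (N n p) - Y p)‖ := by congr 1; abel
      _ ≤ _ := norm_add_le _ _
      _ < 2 * δ := by linarith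
  refine ⟨Y, ?_, fun t ht => ?_⟩
  · refine tendsto_nhds_unique (hY 0 le_rfl) (tendsto_const_nhds.congr fun n => ?_)
    simp [x, N, eulerSeq]
  · rw [hasDerivWithinAt_iff_isLittleO, Asymptotics.isLittleO_iff]
    intro ε hε
    obtain ⟨δ, hδ, hbδ⟩ := Metric.continuousAt_iff.1 (hb.continuousAt (x := Y t)) ε hε
    have hε' : ∀ y, ‖y - Y t‖ < 2 * (δ / 2) → ‖b y - b (Y t)‖ ≤ ε := fun y hy => by
      rw [← dist_eq_norm] at hy ⊢
      exact (hbδ (by linarith)).le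
    have hnear : ∀ᶠ s in 𝓝[Ici 0] t, B * |s - t| < δ / 2 := by
      have hc : Tendsto (fun s => B * |s - t|) (𝓝 t) (𝓝 (B * |t - t|)) :=
        Continuous.tendsto (by fun_prop) t
      refine (hc.mono_left nhdsWithin_le_nhds).eventually_lt_const ?_
      simpa using half_pos hδ
    filter_upwards [hnear, self_mem_nhdsWithin] with s hs hs0
    rcases le_total t s with hts | hts
    · rw [abs_of_nonneg (sub_nonneg.2 hts)] at hs
      rw [Real.norm_of_nonneg (sub_nonneg.2 hts)]
      exact key t s t ε (δ / 2) ht le_rfl hts hs hε'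
    · rw [abs_of_nonpos (sub_nonpos.2 hts), neg_sub] at hs
      rw [Real.norm_of_nonpos (sub_nonpos.2 hts), neg_sub]
      convert key s t t ε (δ / 2) hs0 hts le_rfl hs hε' using 1
      rw [← norm_neg]
      congr 1
      module

end Peano

section Bound

/-- **Osgood's criterion.** A nonnegative function on `[0, L]` with `u' ≤ K ψ(u)` is bounded in
terms of `u 0` when `∫ 1/ψ = ∞`. -/
theorem exists_bound_of_hasDerivWithinAt_le {ψ : ℝ → ℝ} (hψ : Continuous ψ) (hψ1 : ∀ s, 1 ≤ ψ s)
    (hint : ∫⁻ s in Ioi (0 : ℝ), ENNReal.ofReal (1 / ψ s) = ⊤) (K u₀ L : ℝ) (hK : 0 ≤ K) :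
    ∃ M : ℝ, ∀ a, 0 ≤ a → a ≤ L → ∀ u u' : ℝ → ℝ, u 0 ≤ u₀ →
      (∀ t ∈ Icc 0 a, HasDerivWithinAt u (u' t) (Icc 0 a) t) →
      (∀ t ∈ Icc 0 a, u' t ≤ K * ψ (u t)) → u a ≤ M := by
  have hpos : ∀ s, 0 < ψ s := fun s => one_pos.trans_le (hψ1 s)
  have hcont : Continuous fun s => 1 / ψ s := continuous_const.div hψ fun s => (hpos s).ne'
  let G : ℝ → ℝ := fun x => ∫ s in (0 : ℝ)..x, 1 / ψ s
  have hG : ∀ x, HasDerivAt G (1 / ψ x) x := fun x =>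
    (hcont.integral_hasStrictDerivAt 0 x).hasDerivAt
  have hGmono : Monotone G := monotone_of_hasDerivAt_nonneg hG fun x => by
    have := hpos x
    positivity
  have hGunbdd : ∃ M, G u₀ + K * L < G M := by
    by_contra! hle
    have hi : IntegrableOn (fun s => 1 / ψ s) (Ioi 0) := by
      refine integrableOn_Ioi_of_intervalIntegral_norm_bounded (l := atTop) (b := fun x : ℝ => x)
        (G u₀ + K * L) 0 (fun x => (hcont.integrableOn_Icc).mono_set Ioc_subset_Icc_self)
        tendsto_id (Eventually.of_forall fun x => ?_)
      refine le_trans (le_of_eq ?_) (hle x)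
      refine intervalIntegral.integral_congr fun s _ => ?_
      have := hpos s
      exact Real.norm_of_nonneg (by positivity)
    exact hi.lintegral_lt_top.ne hint
  obtain ⟨M, hM⟩ := hGunbdd
  refine ⟨M, fun a ha haL u u' hu0 hu hle => ?_⟩
  have hd : ∀ t ∈ Icc 0 a, HasDerivWithinAt (fun t => G (u t) - K * t)
      (1 / ψ (u t) * u' t - K) (Icc 0 a) t := fun t ht =>
    ((hG (u t)).comp_hasDerivWithinAt t (hu t ht)).sub
      (by simpa using (hasDerivWithinAt_id t (Icc 0 a)).const_mul K)
  have hanti : AntitoneOn (fun t => G (u t) - K * t) (Icc 0 a) := by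
    refine antitoneOn_of_hasDerivWithinAt_nonpos (convex_Icc 0 a)
      (fun t ht => (hd t ht).continuousWithinAt)
      (fun t ht => (hd t (interior_subset ht)).mono interior_subset) fun t ht => ?_
    have h := hle t (interior_subset ht)
    rw [sub_nonpos, one_div, inv_mul_le_iff₀ (hpos _)]
    linarith
  have h := hanti (left_mem_Icc.2 ha) (right_mem_Icc.2 ha) ha
  have h₀ := hGmono hu0
  have hKL := mul_le_mul_of_nonneg_left haL hK
  by_contra! hlt
  have := hGmono hlt.le
  simp only [mul_zero, sub_zero] at h
  linarith

theorem lintegral_one_div_max_eq (r : ℝ → ℝ) :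
    ∫⁻ s in Ioi (0 : ℝ), ENNReal.ofReal (1 / (max s 0 * r (max s 0) + 1))
      = ∫⁻ s in Ioi (0 : ℝ), ENNReal.ofReal (1 / (s * r s + 1)) := by
  refine setLIntegral_congr_fun measurableSet_Ioi fun s hs => ?_
  simp only [max_eq_left (mem_Ioi.1 hs).le]

/-- A differentiable curve whose speed obeys `|X'| ≤ C (|X| r(|X|²) + 1)` satisfies an a priori
bound on `[0, L]` depending only on the size of the initial value. -/
theorem exists_norm_bound_of_growth {E : Type*} [NormedAddCommGroup E] [InnerProductSpace ℝ E]
    {C : ℝ} (hC : 0 ≤ C) {r : ℝ → ℝ} (hr_cont : ContinuousOn r (Ici 0))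
    (hr_nonneg : ∀ s, 0 ≤ s → 0 ≤ r s) (hr_tendsto : Tendsto r atTop atTop)
    (hr_int : ∫⁻ s in Ioi (0 : ℝ), ENNReal.ofReal (1 / (s * r s + 1)) = ⊤) (R L : ℝ) :
    ∃ M : ℝ, ∀ a, 0 ≤ a → a ≤ L → ∀ X X' : ℝ → E, ‖X 0‖ ≤ R →
      (∀ t ∈ Icc 0 a, HasDerivWithinAt X (X' t) (Icc 0 a) t) →
      (∀ t ∈ Icc 0 a, ‖X' t‖ ≤ C * (‖X t‖ * r (‖X t‖ ^ 2) + 1)) → ‖X a‖ ≤ M := by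
  have hmax : Continuous fun s : ℝ => max s 0 := by fun_prop
  have hψ : Continuous fun s => max s 0 * r (max s 0) + 1 :=
    (hmax.mul (hr_cont.comp_continuous hmax fun s => le_max_right s 0)).add continuous_const
  have hψ1 : ∀ s, 1 ≤ max s 0 * r (max s 0) + 1 := fun s =>
    le_add_of_nonneg_left (mul_nonneg (le_max_right _ _) (hr_nonneg _ (le_max_right _ _)))
  obtain ⟨S, hS⟩ := eventually_atTop.1 (hr_tendsto.eventually_ge_atTop 1)
  set D : ℝ := 1 + |S|
  have hD : 1 ≤ D := le_add_of_nonneg_right (abs_nonneg S)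
  obtain ⟨M, hM⟩ := exists_bound_of_hasDerivWithinAt_le hψ hψ1
    ((lintegral_one_div_max_eq r).trans hr_int) (2 * C * (1 + D)) (R ^ 2) L (by positivity)
  refine ⟨√M, fun a ha haL X X' hX0 hX hX' => Real.le_sqrt_of_sq_le ?_⟩
  refine hM a ha haL (fun t => ‖X t‖ ^ 2) _ (by gcongr) (fun t ht => (hX t ht).norm_sq) ?_
  intro t ht
  have hn := norm_nonneg (X t)
  have hrn := hr_nonneg (‖X t‖ ^ 2) (by positivity)
  have hψn : 0 ≤ ‖X t‖ ^ 2 * r (‖X t‖ ^ 2) := by positivity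
  have hlin : ‖X t‖ ≤ D * (‖X t‖ ^ 2 * r (‖X t‖ ^ 2) + 1) := by
    rcases le_total (‖X t‖ ^ 2) S with h | h
    · have h₁ : ‖X t‖ ≤ D := by nlinarith [le_abs_self S]
      nlinarith
    · have h₁ : ‖X t‖ ^ 2 ≤ ‖X t‖ ^ 2 * r (‖X t‖ ^ 2) :=
        le_mul_of_one_le_right (by positivity) (hS _ h)
      have h₂ : ‖X t‖ ≤ ‖X t‖ ^ 2 * r (‖X t‖ ^ 2) + 1 := by nlinarith [sq_nonneg (‖X t‖ - 1)]
      exact h₂.trans (le_mul_of_one_le_left (by positivity) hD)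
  have hi : inner ℝ (X t) (X' t) ≤ ‖X t‖ * (C * (‖X t‖ * r (‖X t‖ ^ 2) + 1)) :=
    (real_inner_le_norm _ _).trans (mul_le_mul_of_nonneg_left (hX' t ht) hn)
  have h0 : max (‖X t‖ ^ 2) 0 = ‖X t‖ ^ 2 := max_eq_left (by positivity)
  simp only [h0]
  have h₂ : ‖X t‖ * (‖X t‖ * r (‖X t‖ ^ 2) + 1)
      ≤ (1 + D) * (‖X t‖ ^ 2 * r (‖X t‖ ^ 2) + 1) := by nlinarith
  nlinarith [mul_le_mul_of_nonneg_left h₂ hC]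

end Bound

section Extension

variable {E : Type*} [NormedAddCommGroup E] [NormedSpace ℝ E]

/-- Existence on `[0, L]` for a continuous vector field dominated by `g`, when all curves whose
speed is dominated by `g` satisfy an a priori bound. -/
theorem exists_hasDerivWithinAt_Icc_of_norm_bound [ProperSpace E] {b : E → E} (hb : Continuous b)
    {g : E → ℝ} (hg : ∀ x, ‖b x‖ ≤ g x) {x₀ : E} {L M : ℝ}
    (hM : ∀ a, 0 ≤ a → a ≤ L → ∀ X X' : ℝ → E, X 0 = x₀ →
      (∀ t ∈ Icc 0 a, HasDerivWithinAt X (X' t) (Icc 0 a) t) →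
      (∀ t ∈ Icc 0 a, ‖X' t‖ ≤ g (X t)) → ‖X a‖ ≤ M) :
    ∃ Y : ℝ → E, Y 0 = x₀ ∧ ∀ t ∈ Icc 0 L, HasDerivWithinAt Y (b (Y t)) (Icc 0 L) t := by
  let φ : E → ℝ := fun x => max 0 (min 1 (M + 1 - ‖x‖))
  have hφ : Continuous φ := by fun_prop
  have hφ0 : ∀ x, 0 ≤ φ x := fun x => le_max_left _ _
  have hφ1 : ∀ x, φ x ≤ 1 := fun x => max_le zero_le_one (min_le_left _ _)
  have hle : ∀ x, ‖φ x • b x‖ ≤ ‖b x‖ := fun x => by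
    rw [norm_smul, Real.norm_of_nonneg (hφ0 x)]
    exact mul_le_of_le_one_left (norm_nonneg _) (hφ1 x)
  obtain ⟨B, hB⟩ := (isCompact_closedBall (0 : E) (M + 1)).exists_bound_of_continuousOn
    hb.continuousOn
  have hbound : ∀ x, ‖φ x • b x‖ ≤ max B 0 := by
    intro x
    by_cases hx : ‖x‖ ≤ M + 1
    · exact (hle x).trans ((hB x (by simpa using hx)).trans (le_max_left _ _))
    · have : φ x = 0 := max_eq_left ((min_le_right _ _).trans (by linarith))
      simp [this]
  obtain ⟨Y, hY0, hY⟩ := exists_hasDerivWithinAt_Ici_of_bounded (hφ.smul hb) hbound x₀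
  refine ⟨Y, hY0, fun t ht => ?_⟩
  have hYt : ‖Y t‖ ≤ M := hM t ht.1 ht.2 Y _ hY0
    (fun s hs => (hY s hs.1).mono Icc_subset_Ici_self) fun s _ => (hle _).trans (hg _)
  have hφt : φ (Y t) = 1 := by
    simp only [φ]
    rw [min_eq_left (by linarith), max_eq_right zero_le_one]
  have h := (hY t ht.1).mono (Icc_subset_Ici_self : Icc 0 L ⊆ Ici 0)
  rwa [Pi.smul_apply', hφt, one_smul] at h

/-- Concatenation of a solution on `[0, a]` with a solution on `[0, c]`. -/
theorem exists_hasDerivWithinAt_Icc_concat {b : E → E} {f g : ℝ → E} {a c : ℝ} (ha : 0 ≤ a)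
    (hc : 0 ≤ c) (hf : ∀ t ∈ Icc 0 a, HasDerivWithinAt f (b (f t)) (Icc 0 a) t)
    (hg : ∀ t ∈ Icc 0 c, HasDerivWithinAt g (b (g t)) (Icc 0 c) t) (hfg : g 0 = f a) :
    ∃ h : ℝ → E, EqOn h f (Icc 0 a) ∧
      ∀ t ∈ Icc 0 (a + c), HasDerivWithinAt h (b (h t)) (Icc 0 (a + c)) t := by
  let h : ℝ → E := fun t => if t ≤ a then f t else g (t - a)
  have h₁ : EqOn h f (Icc 0 a) := fun t ht => if_pos ht.2
  have h₂ : EqOn h (fun t => g (t - a)) (Icc a (a + c)) := by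
    intro t ht
    rcases ht.1.eq_or_lt with rfl | hlt
    · simp [h, hfg]
    · exact if_neg hlt.not_ge
  have hl : ∀ t, HasDerivWithinAt h (b (h t)) (Icc 0 a) t := by
    intro t
    by_cases ht : t ∈ Icc 0 a
    · rw [h₁ ht]
      exact (hf t ht).congr h₁ (h₁ ht)
    · exact HasFDerivWithinAt.of_notMem_closure (by rwa [isClosed_Icc.closure_eq])
  have hr : ∀ t, HasDerivWithinAt h (b (h t)) (Icc a (a + c)) t := by
    intro t
    by_cases ht : t ∈ Icc a (a + c)
    · rw [h₂ ht]
      refine HasDerivWithinAt.congr ?_ h₂ (h₂ ht)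
      have hmaps : MapsTo (fun t => t - a) (Icc a (a + c)) (Icc 0 c) := fun s hs =>
        ⟨by linarith [hs.1], by linarith [hs.2]⟩
      simpa [Function.comp_def] using HasDerivWithinAt.scomp t (hg (t - a) (hmaps ht))
        ((hasDerivWithinAt_id t (Icc a (a + c))).sub_const a) hmaps
    · exact HasFDerivWithinAt.of_notMem_closure (by rwa [isClosed_Icc.closure_eq])
  refine ⟨h, h₁, fun t _ => ?_⟩
  rw [← Icc_union_Icc_eq_Icc ha (le_add_of_nonneg_right hc)]
  exact (hl t).union (hr t)

/-- If the autonomous equation has solutions on `[0, 1]` from every initial point, then every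
solution on `[0, T]` extends to `[0, ∞)`. -/
theorem exists_hasDerivWithinAt_Ici_extension {b : E → E}
    (hstep : ∀ x₀ : E, ∃ Z : ℝ → E, Z 0 = x₀ ∧
      ∀ t ∈ Icc (0 : ℝ) 1, HasDerivWithinAt Z (b (Z t)) (Icc 0 1) t)
    {T : ℝ} (hT : 0 ≤ T) {f : ℝ → E}
    (hf : ∀ t ∈ Icc 0 T, HasDerivWithinAt f (b (f t)) (Icc 0 T) t) :
    ∃ Y : ℝ → E, EqOn Y f (Icc 0 T) ∧
      ∀ t ∈ Ici (0 : ℝ), HasDerivWithinAt Y (b (Y t)) (Ici 0) t := by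
  have hnext : ∀ (n : ℕ) (f : ℝ → E),
      (∀ t ∈ Icc 0 (T + n), HasDerivWithinAt f (b (f t)) (Icc 0 (T + n)) t) →
      ∃ h : ℝ → E, EqOn h f (Icc 0 (T + n)) ∧
        ∀ t ∈ Icc 0 (T + (n + 1 : ℕ)),
          HasDerivWithinAt h (b (h t)) (Icc 0 (T + (n + 1 : ℕ))) t := by
    intro n f hf
    obtain ⟨Z, hZ0, hZ⟩ := hstep (f (T + n))
    have := exists_hasDerivWithinAt_Icc_concat (by positivity) zero_le_one hf hZ hZ0
    simpa only [Nat.cast_add, Nat.cast_one, add_assoc] using this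
  choose! next hnext_eq hnext_deriv using hnext
  let F : ℕ → ℝ → E := fun n => Nat.rec f (fun n h => next n h) n
  have hF : ∀ n : ℕ, ∀ t ∈ Icc 0 (T + n), HasDerivWithinAt (F n) (b (F n t)) (Icc 0 (T + n)) t := by
    intro n
    induction n with
    | zero => simpa [F] using hf
    | succ n ih => exact hnext_deriv n (F n) ih
  have hEq : ∀ {n m : ℕ}, n ≤ m → EqOn (F m) (F n) (Icc 0 (T + n)) := by
    intro n m hnm
    induction m, hnm using Nat.le_induction with
    | base => exact fun _ _ => rfl
    | succ m hnm ih =>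
      have hsub : Icc 0 (T + n) ⊆ Icc 0 (T + m) :=
        Icc_subset_Icc_right (by gcongr)
      exact fun t ht => (hnext_eq m (F m) (hF m) (hsub ht)).trans (ih ht)
  let Y : ℝ → E := fun t => F ⌈t⌉₊ t
  have hYF : ∀ {t : ℝ} {n : ℕ}, 0 ≤ t → t ≤ n → Y t = F n t := fun {t n} ht htn =>
    (hEq (Nat.ceil_le.2 htn) ⟨ht, (Nat.le_ceil t).trans (le_add_of_nonneg_left hT)⟩).symm
  refine ⟨Y, fun t ht => hEq (Nat.zero_le _) (by simpa using ht), fun t ht => ?_⟩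
  obtain ⟨n, hn⟩ := exists_nat_gt t
  have hmem : Icc 0 (n : ℝ) ∈ 𝓝[Ici 0] t := by
    rw [← Ici_inter_Iic]
    exact inter_mem self_mem_nhdsWithin (mem_nhdsWithin_of_mem_nhds (Iic_mem_nhds hn))
  have hd : HasDerivWithinAt (F n) (b (F n t)) (Ici 0) t :=
    (hF n t ⟨ht, hn.le.trans (le_add_of_nonneg_left hT)⟩).mono_of_mem_nhdsWithin
      (mem_of_superset hmem (Icc_subset_Icc_right (le_add_of_nonneg_left hT)))
  rw [hYF ht hn.le]
  exact hd.congr_of_eventuallyEq (by filter_upwards [hmem] with s hs using hYF hs.1 hs.2)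
    (hYF ht hn.le)

/-- A bounded solution on `[0, T)` extends to a solution on `[0, T]`. -/
theorem exists_hasDerivWithinAt_Icc_of_bounded_Ico [FiniteDimensional ℝ E] {b : E → E}
    (hb : Continuous b) {X : ℝ → E} {T M : ℝ} (hT : 0 < T)
    (hX : ∀ t ∈ Ico 0 T, HasDerivWithinAt X (b (X t)) (Ico 0 T) t)
    (hM : ∀ t ∈ Ico 0 T, ‖X t‖ ≤ M) :
    ∃ f : ℝ → E, EqOn f X (Ico 0 T) ∧
      ∀ t ∈ Icc 0 T, HasDerivWithinAt f (b (f t)) (Icc 0 T) t := by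
  have : ProperSpace E := FiniteDimensional.proper_real E
  obtain ⟨B, hB⟩ := (isCompact_closedBall (0 : E) M).exists_bound_of_continuousOn hb.continuousOn
  have hlip : LipschitzOnWith B.toNNReal X (Ico 0 T) :=
    (convex_Ico 0 T).lipschitzOnWith_of_nnnorm_hasDerivWithin_le hX fun t ht => by
      rw [← NNReal.coe_le_coe, coe_nnnorm]
      exact (hB _ (by simpa using hM t ht)).trans (Real.le_coe_toNNReal B)
  obtain ⟨f, hf, hfX⟩ := hlip.extend_finite_dimension
  have hd : ∀ t ∈ Ico 0 T, HasDerivWithinAt f (b (f t)) (Ico 0 T) t := fun t ht => by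
    rw [← hfX ht]
    exact (hX t ht).congr hfX.symm (hfX ht).symm
  have hdIoo : ∀ t ∈ Ioo 0 T, HasDerivAt f (b (f t)) t := fun t ht =>
    (hd t (Ioo_subset_Ico_self ht)).hasDerivAt (Ico_mem_nhds ht.1 ht.2)
  refine ⟨f, hfX.symm, fun t ht => ?_⟩
  rcases ht.2.eq_or_lt with rfl | htT
  · have hIoo : Ioo 0 t ∈ 𝓝[<] t := Ioo_mem_nhdsLT hT
    refine (hasDerivWithinAt_Iic_of_tendsto_deriv (s := Ioo 0 t)
      (fun s hs => (hdIoo s hs).differentiableAt.differentiableWithinAt)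
      hf.continuous.continuousWithinAt hIoo ?_).mono Icc_subset_Iic_self
    refine Tendsto.congr' ?_ (((hb.comp hf.continuous).tendsto t).mono_left nhdsWithin_le_nhds)
    filter_upwards [hIoo] with s hs using (hdIoo s hs).deriv.symm
  · refine (hd t ⟨ht.1, htT⟩).mono_of_mem_nhdsWithin ?_
    exact mem_of_superset
      (inter_mem self_mem_nhdsWithin (mem_nhdsWithin_of_mem_nhds (Iio_mem_nhds htT)))
      fun s hs => ⟨hs.1.1, hs.2⟩

end Extension

/-- **Theorem 2.1 (non-explosion for the ODE).**
If `b : ℝ^d → ℝ^d` is continuous and satisfies the growth condition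
`|b(x)| ≤ C (|x| r(|x|²) + 1)` for a continuous `r : [0,∞) → [0,∞)` with
`r(s) → ∞` and `∫₀^∞ ds/(s r(s) + 1) = ∞`, then every solution
`X : [0,T) → ℝ^d` of `X' = b(X)`, `X(0) = x₀` stays bounded; consequently it
extends to a global solution on `[0,∞)` (the lifetime is infinite). -/
theorem ode_nonexplosion
    (d : ℕ) (b : EuclideanSpace ℝ (Fin d) → EuclideanSpace ℝ (Fin d))
    (hb : Continuous b)
    (C : ℝ) (hC : 0 < C)
    (r : ℝ → ℝ)
    (hr_cont : ContinuousOn r (Set.Ici 0))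
    (hr_nonneg : ∀ s, 0 ≤ s → 0 ≤ r s)
    (hr_tendsto : Filter.Tendsto r Filter.atTop Filter.atTop)
    (hr_int : ∫⁻ s in Set.Ioi (0:ℝ), ENNReal.ofReal (1 / (s * r s + 1)) = ⊤)
    (hgrowth : ∀ x, ‖b x‖ ≤ C * (‖x‖ * r (‖x‖ ^ 2) + 1))
    (x₀ : EuclideanSpace ℝ (Fin d))
    (T : ℝ) (hT : 0 < T)
    (X : ℝ → EuclideanSpace ℝ (Fin d))
    (hX0 : X 0 = x₀)
    (hX : ∀ t ∈ Set.Ico 0 T, HasDerivWithinAt X (b (X t)) (Set.Ico 0 T) t) :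
    (∃ M : ℝ, ∀ t ∈ Set.Ico 0 T, ‖X t‖ ≤ M) ∧
    ∃ Y : ℝ → EuclideanSpace ℝ (Fin d),
      Y 0 = x₀ ∧
      (∀ t ∈ Set.Ici (0:ℝ), HasDerivWithinAt Y (b (Y t)) (Set.Ici 0) t) ∧
      (∀ t ∈ Set.Ico 0 T, Y t = X t) := by
  have hbdd : ∃ M : ℝ, ∀ t ∈ Ico 0 T, ‖X t‖ ≤ M := by
    obtain ⟨M, hM⟩ := exists_norm_bound_of_growth (E := EuclideanSpace ℝ (Fin d)) hC.le hr_cont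
      hr_nonneg hr_tendsto hr_int ‖X 0‖ T
    refine ⟨M, fun t ht => hM t ht.1 ht.2.le X (fun s => b (X s)) le_rfl (fun s hs => ?_)
      fun s _ => hgrowth _⟩
    exact (hX s ⟨hs.1, hs.2.trans_lt ht.2⟩).mono (Icc_subset_Ico_right ht.2)
  refine ⟨hbdd, ?_⟩
  have hstep : ∀ z : EuclideanSpace ℝ (Fin d), ∃ Z : ℝ → EuclideanSpace ℝ (Fin d), Z 0 = z ∧
      ∀ t ∈ Icc (0 : ℝ) 1, HasDerivWithinAt Z (b (Z t)) (Icc 0 1) t := by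
    intro z
    obtain ⟨M, hM⟩ := exists_norm_bound_of_growth (E := EuclideanSpace ℝ (Fin d)) hC.le hr_cont
      hr_nonneg hr_tendsto hr_int ‖z‖ 1
    exact exists_hasDerivWithinAt_Icc_of_norm_bound hb hgrowth fun a ha ha1 Z Z' hZ0 =>
      hM a ha ha1 Z Z' (by rw [hZ0])
  obtain ⟨M, hM⟩ := hbdd
  obtain ⟨f, hfX, hf⟩ := exists_hasDerivWithinAt_Icc_of_bounded_Ico hb hT hX hM
  obtain ⟨Y, hYf, hY⟩ := exists_hasDerivWithinAt_Ici_extension hstep hT.le hf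
  have hYX : ∀ t ∈ Ico 0 T, Y t = X t := fun t ht =>
    (hYf (Ico_subset_Icc_self ht)).trans (hfX ht)
  exact ⟨Y, (hYX 0 ⟨le_rfl, hT⟩).trans hX0, hY, hYX⟩
end

section
/- If X, Y : [0,T) → ℝ^d are differentiable with X(0) = Y(0) = x₀, X'(t) = b(X(t)) and Y'(t) = b(Y(t)) for all t ∈ [0,T), then X(t) = Y(t) for all t ∈ [0,T). In other words, under the stated Osgood-type condition the ODE X' = b(X), X(0) = x₀ has at most one solution. -/
open Set Filter MeasureTheory

/-- If `φ` leaves `0` immediately after time `t₀` and `φ' * g ∘ φ` is bounded above, then `g` is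
integrable near `0`. -/
theorem integrableOn_of_deriv_mul_comp_le {g φ φ' : ℝ → ℝ} {δ t₀ t₁ K : ℝ} (hK : 0 ≤ K)
    (ht : t₀ < t₁) (hg : ContinuousOn g (Ioo 0 δ)) (hg0 : ∀ s ∈ Ioo 0 δ, 0 ≤ g s)
    (hφ : ContinuousOn φ (Icc t₀ t₁)) (hφ0 : φ t₀ = 0) (hφm : ∀ t ∈ Ioc t₀ t₁, φ t ∈ Ioo 0 δ)
    (hφ' : ∀ t ∈ Ioo t₀ t₁, HasDerivAt φ (φ' t) t)
    (hle : ∀ t ∈ Ioo t₀ t₁, φ' t * g (φ t) ≤ K) :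
    IntegrableOn g (Ioc 0 (φ t₁)) := by
  have ha : φ t₁ ∈ Ioo 0 δ := hφm t₁ (right_mem_Ioc.2 ht)
  have hsub : ∀ u ∈ Ioo 0 δ, ∀ v ∈ Ioo 0 δ, uIcc u v ⊆ Ioo 0 δ :=
    fun u hu v hv => ordConnected_Ioo.uIcc_subset hu hv
  have hF : ∀ u ∈ Ioo 0 δ, HasDerivAt (fun u => ∫ s in (φ t₁)..u, g s) (g u) u := by
    intro u hu
    exact intervalIntegral.integral_hasDerivAt_right
      ((hg.mono (hsub _ ha _ hu)).intervalIntegrable)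
      (hg.stronglyMeasurableAtFilter isOpen_Ioo u hu)
      (hg.continuousAt (isOpen_Ioo.mem_nhds hu))
  have hbound : ∀ t ∈ Ioo t₀ t₁, ∫ s in (φ t)..(φ t₁), g s ≤ K * (t₁ - t₀) := by
    intro t htt
    have hd : ∀ x ∈ Ioo t t₁, HasDerivAt (fun x => ∫ s in (φ t₁)..(φ x), g s)
        (g (φ x) * φ' x) x := by
      intro x hx
      have hx' : x ∈ Ioo t₀ t₁ := ⟨htt.1.trans hx.1, hx.2⟩
      exact (hF (φ x) (hφm x (Ioo_subset_Ioc_self hx'))).comp x (hφ' x hx')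
    have h := (convex_Icc t t₁).image_sub_le_mul_sub_of_deriv_le
      (f := fun x => ∫ s in (φ t₁)..(φ x), g s) (C := K) ?_ ?_ ?_ t
      (left_mem_Icc.2 htt.2.le) t₁ (right_mem_Icc.2 htt.2.le) htt.2.le
    · simp only [intervalIntegral.integral_same, zero_sub] at h
      rw [← intervalIntegral.integral_symm] at h
      exact h.trans (by gcongr; exact htt.1.le)
    · intro x hx
      have hx' : x ∈ Ioc t₀ t₁ := ⟨htt.1.trans_le hx.1, hx.2⟩
      exact (hF (φ x) (hφm x hx')).continuousAt.comp_continuousWithinAt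
        ((hφ x (Ioc_subset_Icc_self hx')).mono (Icc_subset_Icc_left htt.1.le))
    · rw [interior_Icc]
      exact fun x hx => (hd x hx).differentiableAt.differentiableWithinAt
    · rw [interior_Icc]
      intro x hx
      rw [(hd x hx).deriv, mul_comm]
      exact hle x ⟨htt.1.trans hx.1, hx.2⟩
  have hmono : ∀ u ∈ Ioo 0 δ, Ioc u (φ t₁) ⊆ Ioo 0 δ :=
    fun u hu s hs => ⟨hu.1.trans hs.1, hs.2.trans_lt ha.2⟩
  obtain ⟨u, -, hu, hulim⟩ := exists_seq_strictAnti_tendsto' ht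
  have hlim : Tendsto (φ ∘ u) atTop (nhds 0) := by
    rw [← hφ0]
    exact (hφ t₀ (left_mem_Icc.2 ht.le)).tendsto.comp
      (tendsto_nhdsWithin_iff.2 ⟨hulim, .of_forall fun n => Ioo_subset_Icc_self (hu n)⟩)
  have hm : ∀ n, φ (u n) ∈ Ioo 0 δ := fun n => hφm _ (Ioo_subset_Ioc_self (hu n))
  refine integrableOn_Ioc_of_intervalIntegral_norm_bounded_left (I := K * (t₁ - t₀))
    (fun n => ?_) hlim (.of_forall fun n => ?_)
  · exact ((hg.mono (ordConnected_Ioo.out (hm n) ha)).integrableOn_Icc).mono_set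
      Ioc_subset_Icc_self
  · rcases le_total (φ (u n)) (φ t₁) with h | h
    · have hnorm : ∫ s in Ioc (φ (u n)) (φ t₁), ‖g s‖ = ∫ s in Ioc (φ (u n)) (φ t₁), g s :=
        setIntegral_congr_fun measurableSet_Ioc fun s hs =>
          Real.norm_of_nonneg (hg0 s (hmono _ (hm n) hs))
      rw [Function.comp_apply, hnorm, ← intervalIntegral.integral_of_le h]
      exact hbound _ (hu n)
    · rw [Function.comp_apply, Ioc_eq_empty h.not_gt, setIntegral_empty]
      exact mul_nonneg hK (sub_nonneg.2 ht.le)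

/-- **Theorem 2.2 (Osgood uniqueness for the ODE).**
If `b : ℝ^d → ℝ^d` is continuous and satisfies
`|b(x) - b(y)| ≤ C |x-y| r(|x-y|²)` for `0 < |x-y| < 1`, where
`r : (0,1) → [0,∞)` is continuous with `r(s) → ∞` as `s → 0` and
`∫₀^a ds/(s r(s)) = ∞` for every `a ∈ (0,1)`, then the ODE
`X' = b(X)`, `X(0) = x₀` has at most one solution on `[0,T)`. -/
theorem ode_osgood_uniqueness
    (d : ℕ) (b : EuclideanSpace ℝ (Fin d) → EuclideanSpace ℝ (Fin d))
    (hb : Continuous b)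
    (C : ℝ) (hC : 0 < C)
    (r : ℝ → ℝ)
    (hr_cont : ContinuousOn r (Set.Ioo 0 1))
    (hr_nonneg : ∀ s ∈ Set.Ioo (0:ℝ) 1, 0 ≤ r s)
    (hr_tendsto : Filter.Tendsto r (nhdsWithin 0 (Set.Ioi 0)) Filter.atTop)
    (hr_int : ∀ a ∈ Set.Ioo (0:ℝ) 1,
      ∫⁻ s in Set.Ioo (0:ℝ) a, ENNReal.ofReal (1 / (s * r s)) = ⊤)
    (hosgood : ∀ x y : EuclideanSpace ℝ (Fin d), 0 < ‖x - y‖ → ‖x - y‖ < 1 →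
      ‖b x - b y‖ ≤ C * (‖x - y‖ * r (‖x - y‖ ^ 2)))
    (x₀ : EuclideanSpace ℝ (Fin d))
    (T : ℝ) (hT : 0 < T)
    (X Y : ℝ → EuclideanSpace ℝ (Fin d))
    (hX0 : X 0 = x₀) (hY0 : Y 0 = x₀)
    (hX : ∀ t ∈ Set.Ico 0 T, HasDerivWithinAt X (b (X t)) (Set.Ico 0 T) t)
    (hY : ∀ t ∈ Set.Ico 0 T, HasDerivWithinAt Y (b (Y t)) (Set.Ico 0 T) t) :
    ∀ t ∈ Set.Ico 0 T, X t = Y t := by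
  intro t₁ ht₁
  by_contra hne
  obtain ⟨ε, hε, hrε⟩ : ∃ ε > 0, ∀ s ∈ Ioo (0:ℝ) ε, 0 < r s := by
    obtain ⟨ε, hε, h⟩ := mem_nhdsGT_iff_exists_Ioo_subset.1 (hr_tendsto.eventually_gt_atTop 0)
    exact ⟨ε, hε, h⟩
  set δ := min ε 1
  have hδ : 0 < δ := lt_min hε one_pos
  have hδε : Ioo 0 δ ⊆ Ioo 0 ε := Ioo_subset_Ioo_right (min_le_left _ _)
  have hδ1 : Ioo 0 δ ⊆ Ioo 0 1 := Ioo_subset_Ioo_right (min_le_right _ _)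
  set φ : ℝ → ℝ := fun t => ‖X t - Y t‖ ^ 2
  have hcont : ContinuousOn φ (Ico 0 T) := by
    have hXc : ContinuousOn X (Ico 0 T) := fun t ht => (hX t ht).continuousWithinAt
    have hYc : ContinuousOn Y (Ico 0 T) := fun t ht => (hY t ht).continuousWithinAt
    exact (hXc.sub hYc).norm.pow 2
  have hcont₁ : ContinuousOn φ (Icc 0 t₁) := hcont.mono fun s hs => ⟨hs.1, hs.2.trans_lt ht₁.2⟩
  have hφ₁ : 0 < φ t₁ := by
    have : 0 < ‖X t₁ - Y t₁‖ := norm_pos_iff.2 (sub_ne_zero.2 hne)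
    positivity
  obtain ⟨t₀, ⟨ht₀, hφt₀⟩, hmax⟩ : ∃ t₀, IsGreatest (Icc 0 t₁ ∩ φ ⁻¹' {0}) t₀ := by
    refine (isCompact_Icc.of_isClosed_subset
      (hcont₁.preimage_isClosed_of_isClosed isClosed_Icc isClosed_singleton)
      inter_subset_left).exists_isGreatest ⟨0, left_mem_Icc.2 ht₁.1, ?_⟩
    simp [φ, hX0, hY0]
  replace hφt₀ : φ t₀ = 0 := hφt₀
  have ht₀₁ : t₀ < t₁ := lt_of_le_of_ne ht₀.2 (by rintro rfl; exact hφ₁.ne' hφt₀)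
  have hpos : ∀ t ∈ Ioc t₀ t₁, 0 < φ t := fun t ht =>
    lt_of_le_of_ne (sq_nonneg _) fun h =>
      ht.1.not_ge (hmax ⟨⟨ht₀.1.trans ht.1.le, ht.2⟩, h.symm⟩)
  obtain ⟨t₂, ht₂, hsmall⟩ : ∃ t₂ ∈ Ioc t₀ t₁, ∀ t ∈ Ioc t₀ t₂, φ t < δ := by
    have hc : Tendsto φ (nhdsWithin t₀ (Ioi t₀)) (nhds 0) := by
      have := ((hcont₁ t₀ ht₀).mono
        (Ioo_subset_Icc_self.trans (Icc_subset_Icc_left ht₀.1) : Ioo t₀ t₁ ⊆ _)).tendsto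
      rwa [nhdsWithin_Ioo_eq_nhdsGT ht₀₁, hφt₀] at this
    obtain ⟨u, hu, h⟩ := (mem_nhdsGT_iff_exists_mem_Ioc_Ioo_subset ht₀₁).1 (hc.eventually_lt_const hδ)
    refine ⟨(t₀ + u) / 2, ⟨by linarith [hu.1], by linarith [hu.1, hu.2]⟩, fun t ht => h ⟨ht.1, ?_⟩⟩
    linarith [hu.1, ht.2]
  have hm : ∀ t ∈ Ioc t₀ t₂, φ t ∈ Ioo 0 δ := fun t ht =>
    ⟨hpos t ⟨ht.1, ht.2.trans ht₂.2⟩, hsmall t ht⟩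
  have hint : IntegrableOn (fun s => 1 / (s * r s)) (Ioc 0 (φ t₂)) := by
    refine integrableOn_of_deriv_mul_comp_le (K := 2 * C) (by positivity) ht₂.1
      (φ' := fun t => 2 * inner ℝ (X t - Y t) (b (X t) - b (Y t)))
      (δ := δ) ?_ ?_ (hcont₁.mono (Icc_subset_Icc ht₀.1 ht₂.2)) hφt₀ hm ?_ ?_
    · exact continuousOn_const.div (continuousOn_id.mul (hr_cont.mono hδ1))
        fun s hs => (mul_pos hs.1 (hrε s (hδε hs))).ne'
    · exact fun s hs => (one_div_pos.2 (mul_pos hs.1 (hrε s (hδε hs)))).le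
    · intro t ht
      have htT : t ∈ Ioo 0 T := ⟨ht₀.1.trans_lt ht.1, (ht.2.trans_le ht₂.2).trans ht₁.2⟩
      have hn : Ico 0 T ∈ nhds t := Ico_mem_nhds htT.1 htT.2
      have htI := Ioo_subset_Ico_self htT
      exact (((hX t htI).hasDerivAt hn).sub ((hY t htI).hasDerivAt hn)).norm_sq
    · intro t ht
      have hmt := hm t (Ioo_subset_Ioc_self ht)
      have hr := hrε _ (hδε hmt)
      have h1 : ‖X t - Y t‖ ^ 2 < 1 := (hδ1 hmt).2
      have h0 : 0 < ‖X t - Y t‖ := by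
        refine (norm_nonneg _).lt_of_ne' fun h => ?_
        have := hmt.1
        simp [φ, h] at this
      have hb' := hosgood (X t) (Y t) h0 (by nlinarith)
      have hin := real_inner_le_norm (X t - Y t) (b (X t) - b (Y t))
      rw [mul_one_div, div_le_iff₀ (mul_pos hmt.1 hr)]
      have := mul_le_mul_of_nonneg_left hb' h0.le
      simp only [φ]
      linarith
  have ht₂m := hm t₂ (right_mem_Ioc.2 ht₂.1)
  have hfin := (hint.mono_set Ioo_subset_Ioc_self).lintegral_lt_top
  exact hfin.ne (hr_int _ (hδ1 ht₂m))
end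

section
/- For every θ with 0 < θ < 1, the following two estimates hold: (i) ∫₁^∞ |sin(sθ)|/s² ds ≤ θ·(log(1/θ) + 1); (ii) |∑_{k=1}^∞ |sin(kθ)|/k² − ∫₁^∞ |sin(sθ)|/s² ds| ≤ π²·θ/2. -/
open MeasureTheory

theorem integrableOn_Ioi_one_div_sq {a : ℝ} (ha : 0 < a) :
    IntegrableOn (fun s : ℝ => 1 / s ^ 2) (Set.Ioi a) := by
  refine (integrableOn_Ioi_rpow_of_lt (a := -2) (by norm_num) ha).congr_fun (fun s hs => ?_)
    measurableSet_Ioi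
  have hs : 0 < s := ha.trans hs
  simp [Real.rpow_neg hs.le]

theorem integral_Ioi_one_div_sq {a : ℝ} (ha : 0 < a) :
    ∫ s in Set.Ioi a, 1 / s ^ 2 = 1 / a := by
  have h : ∫ s in Set.Ioi a, 1 / s ^ 2 = ∫ s in Set.Ioi a, s ^ (-2 : ℝ) := by
    refine setIntegral_congr_fun measurableSet_Ioi (fun s hs => ?_)
    have hs : 0 < s := ha.trans hs
    simp [Real.rpow_neg hs.le]
  rw [h, integral_Ioi_rpow_of_lt (by norm_num) ha]
  norm_num [Real.rpow_neg_one]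

theorem abs_sin_mul_div_sq_le (θ s : ℝ) : |Real.sin (s * θ)| / s ^ 2 ≤ 1 / s ^ 2 := by
  gcongr
  exact Real.abs_sin_le_one _

theorem abs_sin_mul_div_sq_le_div {θ s : ℝ} (hθ : 0 ≤ θ) (hs : 0 < s) :
    |Real.sin (s * θ)| / s ^ 2 ≤ θ * (1 / s) := by
  have h : |Real.sin (s * θ)| ≤ s * θ := by
    simpa [abs_of_nonneg (mul_nonneg hs.le hθ)] using Real.abs_sin_le_abs (x := s * θ)
  calc |Real.sin (s * θ)| / s ^ 2 ≤ s * θ / s ^ 2 := by gcongr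
    _ = θ * (1 / s) := by field_simp

theorem integrableOn_abs_sin_mul_div_sq (θ : ℝ) {a : ℝ} (ha : 0 < a) :
    IntegrableOn (fun s : ℝ => |Real.sin (s * θ)| / s ^ 2) (Set.Ioi a) := by
  refine (integrableOn_Ioi_one_div_sq ha).mono'
    (Measurable.aestronglyMeasurable (by fun_prop)) (.of_forall fun s => ?_)
  rw [Real.norm_of_nonneg (by positivity)]
  exact abs_sin_mul_div_sq_le θ s

theorem intervalIntegrable_abs_sin_mul_div_sq (θ : ℝ) {a b : ℝ} (ha : 0 < a) (hab : a ≤ b) :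
    IntervalIntegrable (fun s : ℝ => |Real.sin (s * θ)| / s ^ 2) volume a b :=
  (intervalIntegrable_iff_integrableOn_Ioc_of_le hab).2
    ((integrableOn_abs_sin_mul_div_sq θ ha).mono_set Set.Ioc_subset_Ioi_self)

theorem integral_Ioi_abs_sin_mul_div_sq_le {θ : ℝ} (hθ0 : 0 < θ) (hθ1 : θ < 1) :
    ∫ s in Set.Ioi (1 : ℝ), |Real.sin (s * θ)| / s ^ 2 ≤ θ * (Real.log (1 / θ) + 1) := by
  have h1 : 1 ≤ 1 / θ := by rw [le_div_iff₀ hθ0]; linarith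
  have hpos : 0 < 1 / θ := by positivity
  have hint := intervalIntegrable_abs_sin_mul_div_sq θ one_pos h1
  have htail := integrableOn_abs_sin_mul_div_sq θ hpos
  rw [← intervalIntegral.integral_interval_add_Ioi
    (integrableOn_abs_sin_mul_div_sq θ one_pos) htail]
  have hA : ∫ s in (1 : ℝ)..(1 / θ), |Real.sin (s * θ)| / s ^ 2 ≤ θ * Real.log (1 / θ) := by
    calc ∫ s in (1 : ℝ)..(1 / θ), |Real.sin (s * θ)| / s ^ 2
        ≤ ∫ s in (1 : ℝ)..(1 / θ), θ * (1 / s) := by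
          refine intervalIntegral.integral_mono_on h1 hint ?_ fun s hs =>
            abs_sin_mul_div_sq_le_div hθ0.le (by linarith [hs.1])
          refine (intervalIntegral.intervalIntegrable_one_div (fun s hs => ?_)
            continuousOn_id).const_mul θ
          rw [Set.uIcc_of_le h1] at hs
          simpa using (zero_lt_one.trans_le hs.1).ne'
      _ = θ * Real.log (1 / θ) := by
          rw [intervalIntegral.integral_const_mul, integral_one_div_of_pos one_pos hpos, div_one]
  have hB : ∫ s in Set.Ioi (1 / θ), |Real.sin (s * θ)| / s ^ 2 ≤ θ := by
    calc ∫ s in Set.Ioi (1 / θ), |Real.sin (s * θ)| / s ^ 2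
        ≤ ∫ s in Set.Ioi (1 / θ), 1 / s ^ 2 :=
          setIntegral_mono htail (integrableOn_Ioi_one_div_sq hpos) (abs_sin_mul_div_sq_le θ)
      _ = θ := by rw [integral_Ioi_one_div_sq hpos, one_div_one_div]
  linarith

theorem abs_abs_sin_mul_div_sq_sub_le {θ k s : ℝ} (hθ : 0 ≤ θ) (hk : 0 < k) (hks : k ≤ s)
    (hsk : s ≤ k + 1) :
    |(|Real.sin (k * θ)| / k ^ 2 - |Real.sin (s * θ)| / s ^ 2)| ≤ 3 * θ / k ^ 2 := by
  have hs : 0 < s := hk.trans_le hks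
  have hlip : |(|Real.sin (k * θ)| - |Real.sin (s * θ)|)| ≤ (s - k) * θ := by
    refine (abs_abs_sub_abs_le_abs_sub _ _).trans ?_
    have h := Real.lipschitzWith_sin.dist_le_mul (k * θ) (s * θ)
    rw [Real.dist_eq, Real.dist_eq, ← sub_mul, abs_mul, abs_of_nonneg hθ, abs_sub_comm k,
      abs_of_nonneg (sub_nonneg.2 hks)] at h
    simpa using h
  have hsin : |Real.sin (k * θ)| ≤ k * θ := by
    simpa [abs_of_nonneg (mul_nonneg hk.le hθ)] using Real.abs_sin_le_abs (x := k * θ)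
  have hinv : 0 ≤ 1 / k ^ 2 - 1 / s ^ 2 := sub_nonneg.2 (by gcongr)
  calc |(|Real.sin (k * θ)| / k ^ 2 - |Real.sin (s * θ)| / s ^ 2)|
      = |(|Real.sin (k * θ)| - |Real.sin (s * θ)|) * (1 / s ^ 2)
          + |Real.sin (k * θ)| * (1 / k ^ 2 - 1 / s ^ 2)| := by ring_nf
    _ ≤ |(|Real.sin (k * θ)| - |Real.sin (s * θ)|)| * (1 / s ^ 2)
          + |Real.sin (k * θ)| * (1 / k ^ 2 - 1 / s ^ 2) := by
        refine (abs_add_le _ _).trans_eq ?_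
        rw [abs_mul, abs_mul, abs_abs, abs_of_nonneg hinv,
          abs_of_nonneg (by positivity : 0 ≤ 1 / s ^ 2)]
    _ ≤ (s - k) * θ * (1 / s ^ 2) + k * θ * (1 / k ^ 2 - 1 / s ^ 2) := by gcongr
    _ = (s - k) * θ * ((2 * k + s) / (k * s ^ 2)) := by field_simp; ring
    _ ≤ 1 * θ * (3 / k ^ 2) := by
        have : (2 * k + s) / (k * s ^ 2) ≤ 3 / k ^ 2 := by
          rw [div_le_div_iff₀ (by positivity) (by positivity)]
          nlinarith [mul_nonneg (sub_nonneg.2 hks) (mul_pos hk hk).le,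
            mul_nonneg (sub_nonneg.2 hks) (mul_pos hk hs).le,
            mul_nonneg (sub_nonneg.2 hks) (mul_pos hs hs).le]
        gcongr
        linarith
    _ = 3 * θ / k ^ 2 := by ring

theorem abs_abs_sin_mul_div_sq_sub_integral_le {θ k : ℝ} (hθ : 0 ≤ θ) (hk : 0 < k) :
    |(|Real.sin (k * θ)| / k ^ 2 - ∫ s in k..(k + 1), |Real.sin (s * θ)| / s ^ 2)|
      ≤ 3 * θ / k ^ 2 := by
  have hle : k ≤ k + 1 := by linarith
  have hsub : |Real.sin (k * θ)| / k ^ 2 - ∫ s in k..(k + 1), |Real.sin (s * θ)| / s ^ 2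
      = ∫ s in k..(k + 1), (|Real.sin (k * θ)| / k ^ 2 - |Real.sin (s * θ)| / s ^ 2) := by
    rw [intervalIntegral.integral_sub (by simp)
      (intervalIntegrable_abs_sin_mul_div_sq θ hk hle)]
    simp
  rw [hsub]
  have hbound := intervalIntegral.norm_integral_le_of_norm_le_const (C := 3 * θ / k ^ 2)
    (f := fun s => |Real.sin (k * θ)| / k ^ 2 - |Real.sin (s * θ)| / s ^ 2)
    (a := k) (b := k + 1) fun s hs => by
      rw [Set.uIoc_of_le hle] at hs
      exact abs_abs_sin_mul_div_sq_sub_le hθ hk hs.1.le hs.2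
  rwa [add_sub_cancel_left, abs_one, mul_one] at hbound

theorem hasSum_one_div_succ_sq :
    HasSum (fun n : ℕ => 1 / ((n : ℝ) + 1) ^ 2) (Real.pi ^ 2 / 6) := by
  simpa using (hasSum_nat_add_iff' 1).2 hasSum_zeta_two

theorem abs_tsum_sub_integral_Ioi_abs_sin_mul_div_sq_le {θ : ℝ} (hθ : 0 ≤ θ) :
    |(∑' k : ℕ+, |Real.sin ((k : ℝ) * θ)| / (k : ℝ) ^ 2)
        - ∫ s in Set.Ioi (1 : ℝ), |Real.sin (s * θ)| / s ^ 2| ≤ Real.pi ^ 2 * θ / 2 := by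
  set f : ℝ → ℝ := fun s => |Real.sin (s * θ)| / s ^ 2 with hf
  have hsum : Summable fun n : ℕ => f (n + 1) :=
    hasSum_one_div_succ_sq.summable.of_nonneg_of_le (fun n => by positivity)
      fun n => abs_sin_mul_div_sq_le θ _
  have htsum : ∑' k : ℕ+, f k = ∑' n : ℕ, f (n + 1) := by
    simpa using tsum_pnat_eq_tsum_succ (f := fun n : ℕ => f n)
  have hlim : Filter.Tendsto
      (fun N : ℕ => ∑ n ∈ Finset.range N, f (n + 1) - ∫ s in (1 : ℝ)..(N + 1), f s)
      Filter.atTop (nhds (∑' k : ℕ+, f k - ∫ s in Set.Ioi (1 : ℝ), f s)) := by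
    rw [htsum]
    exact hsum.hasSum.tendsto_sum_nat.sub <| intervalIntegral_tendsto_integral_Ioi 1
      (integrableOn_abs_sin_mul_div_sq θ one_pos)
      (Filter.tendsto_atTop_add_const_right _ _ tendsto_natCast_atTop_atTop)
  refine le_of_tendsto hlim.abs (.of_forall fun N => ?_)
  have hadj : ∑ n ∈ Finset.range N, ∫ s in ((n : ℝ) + 1)..((n : ℝ) + 1 + 1), f s
      = ∫ s in (1 : ℝ)..(N + 1), f s := by
    simpa using intervalIntegral.sum_integral_adjacent_intervals (f := f) (μ := volume)
      (a := fun n : ℕ => (n : ℝ) + 1) (n := N) fun n _ => by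
        refine intervalIntegrable_abs_sin_mul_div_sq θ (by positivity) ?_
        push_cast
        linarith
  calc |∑ n ∈ Finset.range N, f (n + 1) - ∫ s in (1 : ℝ)..(N + 1), f s|
      = |∑ n ∈ Finset.range N,
          (f (n + 1) - ∫ s in ((n : ℝ) + 1)..((n : ℝ) + 1 + 1), f s)| := by
        rw [Finset.sum_sub_distrib, hadj]
    _ ≤ ∑ n ∈ Finset.range N, 3 * θ * (1 / ((n : ℝ) + 1) ^ 2) := by
        refine (Finset.abs_sum_le_sum_abs _ _).trans (Finset.sum_le_sum fun n _ => ?_)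
        rw [mul_one_div]
        exact abs_abs_sin_mul_div_sq_sub_integral_le hθ (by positivity)
    _ ≤ 3 * θ * (Real.pi ^ 2 / 6) := by
        rw [← Finset.mul_sum]
        gcongr
        exact sum_le_hasSum _ (fun n _ => by positivity) hasSum_one_div_succ_sq
    _ = Real.pi ^ 2 * θ / 2 := by ring

/-- **Estimates from the proof of Lemma 2.4.** For `0 < θ < 1`:
(i) `∫₁^∞ |sin(sθ)|/s² ds ≤ θ (log(1/θ) + 1)`;
(ii) `|∑_{k≥1} |sin(kθ)|/k² − ∫₁^∞ |sin(sθ)|/s² ds| ≤ π² θ / 2`. -/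
theorem sin_series_integral_estimates
    (θ : ℝ) (hθ0 : 0 < θ) (hθ1 : θ < 1) :
    (∫ s in Set.Ioi (1:ℝ), |Real.sin (s * θ)| / s ^ 2)
        ≤ θ * (Real.log (1 / θ) + 1) ∧
    |(∑' k : ℕ+, |Real.sin ((k : ℝ) * θ)| / (k : ℝ) ^ 2)
        - ∫ s in Set.Ioi (1:ℝ), |Real.sin (s * θ)| / s ^ 2|
        ≤ Real.pi ^ 2 * θ / 2 := by
  exact ⟨integral_Ioi_abs_sin_mul_div_sq_le hθ0 hθ1,
    abs_tsum_sub_integral_Ioi_abs_sin_mul_div_sq_le hθ0.le⟩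
end

section
/- The function f : ℝ² → ℝ defined by f(x₁,x₂) = ∑_{k=1}^∞ sin(k x₁)·sin(k x₂)/k² is continuous, and there exists a constant C > 0 such that |f(X) − f(Y)| ≤ C·|X−Y|·log(1/|X−Y|) for all X, Y ∈ ℝ² with 0 < |X−Y| < 1/e. -/
/-- The `k`-th term of the series `∑ sin (k x) sin (k y) / k ^ 2`. -/
noncomputable def sinSinTerm (k : ℕ) (x y : ℝ) : ℝ :=
  Real.sin (k * x) * Real.sin (k * y) / (k : ℝ) ^ 2

theorem sinSinTerm_zero (x y : ℝ) : sinSinTerm 0 x y = 0 := by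
  simp [sinSinTerm]

theorem abs_sinSinTerm_le (k : ℕ) (x y : ℝ) : |sinSinTerm k x y| ≤ ((k : ℝ) ^ 2)⁻¹ := by
  rw [sinSinTerm, abs_div, abs_mul, abs_of_nonneg (sq_nonneg (k : ℝ)), div_eq_mul_inv]
  refine mul_le_of_le_one_left (by positivity) ?_
  exact mul_le_one₀ (Real.abs_sin_le_one _) (abs_nonneg _) (Real.abs_sin_le_one _)

theorem summable_sinSinTerm (x y : ℝ) : Summable fun k : ℕ => sinSinTerm k x y :=
  Summable.of_norm_bounded (Real.summable_nat_pow_inv.mpr one_lt_two)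
    fun k => abs_sinSinTerm_le k x y

theorem abs_sinSinTerm_sub_le_inv_sq (k : ℕ) (x y x' y' : ℝ) :
    |sinSinTerm k x y - sinSinTerm k x' y'| ≤ 2 * ((k : ℝ) ^ 2)⁻¹ := by
  have h := abs_sub (sinSinTerm k x y) (sinSinTerm k x' y')
  linarith [abs_sinSinTerm_le k x y, abs_sinSinTerm_le k x' y']

theorem abs_sinSinTerm_sub_le_inv (k : ℕ) {x y x' y' d : ℝ}
    (hx : |x - x'| ≤ d) (hy : |y - y'| ≤ d) :
    |sinSinTerm k x y - sinSinTerm k x' y'| ≤ 2 * d * (k : ℝ)⁻¹ := by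
  rcases Nat.eq_zero_or_pos k with rfl | hk
  · simp [sinSinTerm]
  have hk' : (0 : ℝ) < k := by exact_mod_cast hk
  have key : ∀ {u v : ℝ}, |u - v| ≤ d → |Real.sin (k * u) - Real.sin (k * v)| ≤ k * d := by
    intro u v h
    refine (Real.abs_sin_sub_sin_le _ _).trans ?_
    rw [← mul_sub, abs_mul, abs_of_pos hk']
    gcongr
  have hnum : |Real.sin (k * x) * Real.sin (k * y) - Real.sin (k * x') * Real.sin (k * y')|
      ≤ 2 * (k * d) := by
    calc |Real.sin (k * x) * Real.sin (k * y) - Real.sin (k * x') * Real.sin (k * y')|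
        = |(Real.sin (k * x) - Real.sin (k * x')) * Real.sin (k * y)
            + Real.sin (k * x') * (Real.sin (k * y) - Real.sin (k * y'))| := by
          congr 1; ring
      _ ≤ |Real.sin (k * x) - Real.sin (k * x')| * |Real.sin (k * y)|
            + |Real.sin (k * x')| * |Real.sin (k * y) - Real.sin (k * y')| := by
          rw [← abs_mul, ← abs_mul]; exact abs_add_le _ _
      _ ≤ (k * d) * 1 + 1 * (k * d) := by
          gcongr
          · exact (abs_nonneg _).trans (key hx)
          · exact key hx
          · exact Real.abs_sin_le_one _
          · exact Real.abs_sin_le_one _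
          · exact key hy
      _ = 2 * (k * d) := by ring
  rw [sinSinTerm, sinSinTerm, ← sub_div, abs_div, abs_of_nonneg (sq_nonneg (k : ℝ)),
    div_le_iff₀ (by positivity)]
  refine hnum.trans_eq ?_
  field_simp

/-- Splitting at `N` a sum whose terms are bounded both by `A / k` and by `B / k ^ 2`. -/
theorem sum_range_le_of_le_inv_of_le_inv_sq {t : ℕ → ℝ} {A B : ℝ} (hA : 0 ≤ A) (hB : 0 ≤ B)
    (h₁ : ∀ k : ℕ, t k ≤ A * (k : ℝ)⁻¹) (h₂ : ∀ k : ℕ, t k ≤ B * ((k : ℝ) ^ 2)⁻¹) (N n : ℕ) :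
    ∑ k ∈ Finset.range n, t k ≤ A * (1 + Real.log N) + B * (2 / (N + 1)) := by
  rw [← Finset.sum_filter_add_sum_filter_not (Finset.range n) (· ≤ N)]
  refine add_le_add ?_ ?_
  · calc ∑ k ∈ Finset.range n with k ≤ N, t k
        ≤ ∑ k ∈ Finset.range n with k ≤ N, A * (k : ℝ)⁻¹ := Finset.sum_le_sum fun k _ => h₁ k
      _ ≤ ∑ k ∈ Finset.range (N + 1), A * (k : ℝ)⁻¹ := by
          refine Finset.sum_le_sum_of_subset_of_nonneg ?_ fun k _ _ => by positivity
          intro k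
          simp only [Finset.mem_filter, Finset.mem_range]
          lia
      _ = A * harmonic N := by
          rw [← Finset.mul_sum, Finset.sum_range_succ', harmonic]
          simp
      _ ≤ A * (1 + Real.log N) := by
          gcongr
          exact harmonic_le_one_add_log N
  · calc ∑ k ∈ Finset.range n with ¬ k ≤ N, t k
        ≤ ∑ k ∈ Finset.range n with ¬ k ≤ N, B * ((k : ℝ) ^ 2)⁻¹ :=
          Finset.sum_le_sum fun k _ => h₂ k
      _ ≤ ∑ k ∈ Finset.Ioo N n, B * ((k : ℝ) ^ 2)⁻¹ := by
          refine Finset.sum_le_sum_of_subset_of_nonneg ?_ fun k _ _ => by positivity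
          intro k
          simp only [Finset.mem_filter, Finset.mem_range, Finset.mem_Ioo]
          lia
      _ ≤ B * (2 / (N + 1)) := by
          rw [← Finset.mul_sum]
          gcongr
          exact sum_Ioo_inv_sq_le N n

theorem abs_tsum_sinSinTerm_sub_le {x y x' y' d : ℝ} (hd : 0 < d) (hd' : d < 1 / Real.exp 1)
    (hx : |x - x'| ≤ d) (hy : |y - y'| ≤ d) :
    |∑' k : ℕ, sinSinTerm k x y - ∑' k : ℕ, sinSinTerm k x' y'| ≤ 8 * d * Real.log (1 / d) := by
  have hexp : Real.exp 1 < 1 / d := (lt_one_div hd (Real.exp_pos 1)).mp hd'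
  have hL : 1 ≤ Real.log (1 / d) := by
    rw [Real.le_log_iff_exp_le (by positivity)]
    exact hexp.le
  have hN : 0 < ⌊1 / d⌋₊ := by
    rw [Nat.floor_pos]
    linarith [Real.add_one_le_exp (1 : ℝ)]
  have hlog : Real.log ⌊1 / d⌋₊ ≤ Real.log (1 / d) :=
    Real.log_le_log (by exact_mod_cast hN) (Nat.floor_le (by positivity))
  have htail : 2 / ((⌊1 / d⌋₊ : ℝ) + 1) ≤ 2 * d := by
    rw [div_le_iff₀ (by positivity)]
    have h := (div_lt_iff₀ hd).mp (Nat.lt_floor_add_one (1 / d))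
    linarith
  rw [← (summable_sinSinTerm x y).tsum_sub (summable_sinSinTerm x' y')]
  have hsum := ((summable_sinSinTerm x y).sub (summable_sinSinTerm x' y')).hasSum
  refine le_of_tendsto hsum.tendsto_sum_nat.abs (Filter.Eventually.of_forall fun n => ?_)
  calc |∑ k ∈ Finset.range n, (sinSinTerm k x y - sinSinTerm k x' y')|
      ≤ ∑ k ∈ Finset.range n, |sinSinTerm k x y - sinSinTerm k x' y'| :=
        Finset.abs_sum_le_sum_abs _ _
    _ ≤ 2 * d * (1 + Real.log ⌊1 / d⌋₊) + 2 * (2 / ((⌊1 / d⌋₊ : ℝ) + 1)) :=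
        sum_range_le_of_le_inv_of_le_inv_sq (by positivity) zero_le_two
          (fun k => abs_sinSinTerm_sub_le_inv k hx hy)
          (fun k => abs_sinSinTerm_sub_le_inv_sq k x y x' y') _ n
    _ ≤ 2 * d * (1 + Real.log (1 / d)) + 2 * (2 * d) := by gcongr
    _ ≤ 8 * d * Real.log (1 / d) := by nlinarith

/-- **Example 2.3.** The function `f(x₁,x₂) = ∑_{k≥1} sin(k x₁) sin(k x₂) / k²`
is continuous on `ℝ²`, and there is a constant `C > 0` with
`|f(X) − f(Y)| ≤ C |X−Y| log(1/|X−Y|)` whenever `0 < |X−Y| < 1/e`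
(`|·|` being the Euclidean distance on `ℝ²`). -/
theorem example_log_lipschitz_function
    (f : EuclideanSpace ℝ (Fin 2) → ℝ)
    (hf : ∀ X : EuclideanSpace ℝ (Fin 2),
      f X = ∑' k : ℕ+, Real.sin ((k : ℝ) * X 0) * Real.sin ((k : ℝ) * X 1) / (k : ℝ) ^ 2) :
    Continuous f ∧
    ∃ C : ℝ, 0 < C ∧
      ∀ X Y : EuclideanSpace ℝ (Fin 2),
        0 < ‖X - Y‖ → ‖X - Y‖ < 1 / Real.exp 1 →
        |f X - f Y| ≤ C * ‖X - Y‖ * Real.log (1 / ‖X - Y‖) := by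
  have hf' : f = fun X => ∑' k : ℕ, sinSinTerm k (X 0) (X 1) := by
    funext X
    rw [hf X]
    exact tsum_pnat_eq_tsum_of_eq_zero (f := fun k => sinSinTerm k (X 0) (X 1))
      (sinSinTerm_zero (X 0) (X 1))
  subst hf'
  refine ⟨?_, 8, by norm_num, fun X Y h₀ h₁ => ?_⟩
  · refine continuous_tsum (fun k => ?_) (Real.summable_nat_pow_inv.mpr one_lt_two)
      fun k X => abs_sinSinTerm_le k (X 0) (X 1)
    unfold sinSinTerm
    fun_prop
  · exact abs_tsum_sinSinTerm_sub_le h₀ h₁ (PiLp.norm_apply_le (X - Y) 0)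
      (PiLp.norm_apply_le (X - Y) 1)
end

section
/- For every x₀ ∈ ℝ^d, every t ≥ 0 and every ε > 0 there exists δ > 0 such that whenever |y₀ − x₀| < δ, one has sup_{0 ≤ s ≤ t} |X_s(y₀) − X_s(x₀)| ≤ ε. In particular, for each t ≥ 0 the map x₀ ↦ X_t(x₀) is continuous on ℝ^d. -/
open Set Filter MeasureTheory

/-- If `g` is continuous on `(0, a]` and `∫₀^a g = ∞`, then its integrals over `[ρ, a]` are
unbounded as `ρ` decreases to `0`. -/
theorem exists_lt_intervalIntegral_of_lintegral_eq_top {g : ℝ → ℝ} {a : ℝ} (ha : 0 < a)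
    (hg : ContinuousOn g (Ioc 0 a)) (hg0 : ∀ s ∈ Ioc 0 a, 0 ≤ g s)
    (htop : ∫⁻ s in Ioo 0 a, ENNReal.ofReal (g s) = ⊤) (M : ℝ) :
    ∃ ρ ∈ Ioo 0 a, M < ∫ s in ρ..a, g s := by
  by_contra! hM
  have hlt : ∀ n : ℕ, a / (n + 2) ∈ Ioo 0 a := fun n =>
    ⟨by positivity, div_lt_self ha (by linarith [n.cast_nonneg (α := ℝ)])⟩
  have hunion : Ioo 0 a = ⋃ n : ℕ, Ioo (a / (n + 2)) a := by
    ext s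
    simp only [mem_iUnion, mem_Ioo]
    constructor
    · rintro ⟨h0, h1⟩
      obtain ⟨n, hn⟩ := exists_nat_gt (a / s)
      refine ⟨n, ?_, h1⟩
      rw [div_lt_iff₀ h0] at hn
      rw [div_lt_iff₀ (by positivity)]
      nlinarith
    · rintro ⟨n, h0, h1⟩
      exact ⟨(hlt n).1.trans h0, h1⟩
  have hmono : Monotone fun n : ℕ => Ioo (a / ((n : ℝ) + 2)) a := by
    intro m n hmn
    refine Ioo_subset_Ioo_left ?_
    gcongr
  have hbound : ∀ n : ℕ, ∫⁻ s in Ioo (a / (n + 2)) a, ENNReal.ofReal (g s) ≤ ENNReal.ofReal M := by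
    intro n
    have hsub : Icc (a / ((n : ℝ) + 2)) a ⊆ Ioc 0 a := fun s hs => ⟨(hlt n).1.trans_le hs.1, hs.2⟩
    have hint : IntegrableOn g (Ioc (a / ((n : ℝ) + 2)) a) :=
      ((hg.mono hsub).integrableOn_Icc).mono_set Ioc_subset_Icc_self
    have hnn : 0 ≤ᵐ[volume.restrict (Ioc (a / ((n : ℝ) + 2)) a)] g :=
      (ae_restrict_iff' measurableSet_Ioc).2
        (.of_forall fun s hs => hg0 s (hsub (Ioc_subset_Icc_self hs)))
    calc ∫⁻ s in Ioo (a / (n + 2)) a, ENNReal.ofReal (g s)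
        ≤ ∫⁻ s in Ioc (a / (n + 2)) a, ENNReal.ofReal (g s) :=
          lintegral_mono_set Ioo_subset_Ioc_self
      _ = ENNReal.ofReal (∫ s in Ioc (a / (n + 2)) a, g s) :=
          (ofReal_integral_eq_lintegral_ofReal hint hnn).symm
      _ ≤ ENNReal.ofReal M := by
          rw [← intervalIntegral.integral_of_le (hlt n).2.le]
          exact ENNReal.ofReal_le_ofReal (hM _ (hlt n))
  rw [hunion, setLIntegral_iUnion_of_directed _ hmono.directed_le] at htop
  exact ENNReal.ofReal_ne_top (top_le_iff.1 (htop ▸ iSup_le hbound))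

/-- Bihari-type comparison: if `u' ≤ K / g u` while `u` lies in `[ρ, η]`, then starting below `ρ`
the function `u` cannot reach `η` before the time `t` as soon as `K t < ∫_ρ^η g`. -/
theorem lt_of_mul_deriv_le_of_mul_lt_integral {g u u' : ℝ → ℝ} {ρ η K t : ℝ} (hρη : ρ ≤ η)
    (hg : ContinuousOn g (Icc ρ η)) (hg0 : ∀ v ∈ Icc ρ η, 0 < g v)
    (hu : ContinuousOn u (Icc 0 t))
    (hu' : ∀ s ∈ Ico 0 t, HasDerivWithinAt u (u' s) (Ici s) s) (hu0 : u 0 ≤ ρ) (hK : 0 ≤ K)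
    (hbd : ∀ s ∈ Ico 0 t, u s ∈ Icc ρ η → g (u s) * u' s < K)
    (ht : K * t < ∫ v in ρ..η, g v) {s : ℝ} (hs : s ∈ Icc 0 t) : u s < η := by
  set G : ℝ → ℝ := IccExtend hρη ((Icc ρ η).domRestrict g) with hG
  have hGc : Continuous G := (continuousOn_iff_continuous_domRestrict.1 hg).Icc_extend'
  have hGpos : ∀ v, 0 < G v := fun v => hg0 _ (projIcc ρ η hρη v).2
  have hGeq : ∀ v ∈ Icc ρ η, G v = g v := fun v hv => by
    rw [hG, IccExtend_of_mem _ _ hv, domRestrict_apply]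
  set H : ℝ → ℝ := fun v => ∫ w in ρ..v, G w
  have hHd : ∀ v, HasDerivAt H (G v) v := fun v => hGc.integral_hasStrictDerivAt ρ v |>.hasDerivAt
  have hHm : StrictMono H := strictMono_of_hasDerivAt_pos hHd hGpos
  have hHρ : H ρ = 0 := intervalIntegral.integral_same
  have hHη : K * t < H η := by
    rwa [show H η = ∫ v in ρ..η, g v from
      intervalIntegral.integral_congr fun v hv => hGeq v (uIcc_of_le hρη ▸ hv)]
  have hHc : Continuous H := continuous_iff_continuousAt.2 fun v => (hHd v).continuousAt
  have key := image_le_of_deriv_right_lt_deriv_boundary (f := H ∘ u) (f' := fun s => G (u s) * u' s)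
    (a := 0) (b := t) (B := fun s => K * s) (B' := fun _ => K)
    (hHc.comp_continuousOn hu)
    (fun s hs => (hHd (u s)).comp_hasDerivWithinAt s (hu' s hs))
    (by simpa [hHρ] using hHm.monotone hu0)
    (fun s => by simpa using (hasDerivAt_id s).const_mul K)
    (fun s hs hsB => by
      have hsB : H (u s) = K * s := hsB
      have hmem : u s ∈ Icc ρ η := by
        refine ⟨hHm.le_iff_le.1 ?_, hHm.le_iff_le.1 ?_⟩
        · rw [hHρ, hsB]
          exact mul_nonneg hK hs.1
        · rw [hsB]
          exact (mul_le_mul_of_nonneg_left hs.2.le hK).trans hHη.le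
      simpa [hGeq _ hmem] using hbd s hs hmem)
  exact hHm.lt_iff_lt.1 (((key hs).trans (mul_le_mul_of_nonneg_left hs.2 hK)).trans_lt hHη)

/-- Under an Osgood modulus of continuity, solutions of `x' = b x` which start close enough to each
other stay within distance `ε` up to time `t`, with a closeness depending only on `ε` and `t`. -/
theorem exists_forall_norm_sub_le_of_osgood {E : Type*} [NormedAddCommGroup E]
    [InnerProductSpace ℝ E] {b : E → E} {K : ℝ} (hK : 0 < K) {r : ℝ → ℝ}
    (hr_cont : ContinuousOn r (Ioo 0 1))
    (hr_tendsto : Tendsto r (nhdsWithin 0 (Ioi 0)) atTop)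
    (hr_int : ∀ a ∈ Ioo (0 : ℝ) 1, ∫⁻ s in Ioo (0 : ℝ) a, ENNReal.ofReal (1 / (s * r s)) = ⊤)
    (hosgood : ∀ x y : E, 0 < ‖x - y‖ → ‖x - y‖ < 1 →
      ‖b x - b y‖ ≤ K * (‖x - y‖ * r (‖x - y‖ ^ 2)))
    {t ε : ℝ} (ht : 0 ≤ t) (hε : 0 < ε) :
    ∃ δ > 0, ∀ x y : ℝ → E,
      (∀ s ∈ Ici (0 : ℝ), HasDerivWithinAt x (b (x s)) (Ici 0) s) →
      (∀ s ∈ Ici (0 : ℝ), HasDerivWithinAt y (b (y s)) (Ici 0) s) →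
      ‖x 0 - y 0‖ < δ → ∀ s ∈ Icc 0 t, ‖x s - y s‖ ≤ ε := by
  obtain ⟨c, hc, hrc⟩ := mem_nhdsGT_iff_exists_Ioc_subset.1 (hr_tendsto.eventually_gt_atTop 0)
  obtain ⟨η, hη0, hηlt⟩ : ∃ η, 0 < η ∧ η < min c (min 1 (ε ^ 2)) :=
    exists_between (lt_min hc (lt_min one_pos (by positivity)))
  obtain ⟨hηc, hη1, hηε⟩ : η < c ∧ η < 1 ∧ η < ε ^ 2 := by simpa using hηlt
  have hrpos : ∀ s ∈ Ioc 0 η, 0 < r s := fun s hs => hrc ⟨hs.1, hs.2.trans hηc.le⟩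
  have hpos : ∀ s ∈ Ioc 0 η, 0 < s * r s := fun s hs => mul_pos hs.1 (hrpos s hs)
  have hcont : ContinuousOn (fun s => 1 / (s * r s)) (Ioc 0 η) :=
    continuousOn_const.div
      (continuousOn_id.mul (hr_cont.mono fun s hs => ⟨hs.1, hs.2.trans_lt hη1⟩))
      fun s hs => (hpos s hs).ne'
  obtain ⟨ρ, ⟨hρ0, hρη⟩, hρ⟩ := exists_lt_intervalIntegral_of_lintegral_eq_top hη0 hcont
    (fun s hs => (one_div_pos.2 (hpos s hs)).le) (hr_int η ⟨hη0, hη1⟩) ((2 * K + 1) * t)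
  have hsub : Icc ρ η ⊆ Ioc 0 η := fun s hs => ⟨hρ0.trans_le hs.1, hs.2⟩
  refine ⟨√ρ, Real.sqrt_pos.2 hρ0, fun x y hx hy hxy s hs => ?_⟩
  have hd : ∀ s ∈ Ici (0 : ℝ), HasDerivWithinAt (fun s => ‖x s - y s‖ ^ 2)
      (2 * inner ℝ (x s - y s) (b (x s) - b (y s))) (Ici 0) s :=
    fun s hs => ((hx s hs).sub (hy s hs)).norm_sq
  have hlt : ‖x s - y s‖ ^ 2 < η := by
    refine lt_of_mul_deriv_le_of_mul_lt_integral (u := fun s => ‖x s - y s‖ ^ 2)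
      hρη.le (hcont.mono hsub) (fun v hv => one_div_pos.2 (hpos v (hsub hv)))
      (fun s hs => (hd s hs.1).continuousWithinAt.mono Icc_subset_Ici_self)
      (fun s hs => (hd s hs.1).mono (Ici_subset_Ici.2 hs.1)) ?_ (by positivity)
      (fun s hs hmem => ?_) hρ hs
    · exact ((Real.lt_sqrt (norm_nonneg _)).1 hxy).le
    · have hv := hsub hmem
      have hn0 : 0 < ‖x s - y s‖ :=
        (norm_nonneg _).lt_of_ne' (ne_zero_pow two_ne_zero hv.1.ne')
      have hn1 : ‖x s - y s‖ < 1 :=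
        (sq_lt_one_iff₀ (norm_nonneg _)).1 (hv.2.trans_lt hη1)
      have hinner : inner ℝ (x s - y s) (b (x s) - b (y s)) ≤
          K * (‖x s - y s‖ ^ 2 * r (‖x s - y s‖ ^ 2)) :=
        calc inner ℝ (x s - y s) (b (x s) - b (y s))
            ≤ ‖x s - y s‖ * ‖b (x s) - b (y s)‖ := real_inner_le_norm _ _
          _ ≤ ‖x s - y s‖ * (K * (‖x s - y s‖ * r (‖x s - y s‖ ^ 2))) := by
              gcongr
              exact hosgood _ _ hn0 hn1
          _ = K * (‖x s - y s‖ ^ 2 * r (‖x s - y s‖ ^ 2)) := by ring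
      rw [one_div_mul_eq_div, div_lt_iff₀ (hpos _ hv)]
      nlinarith [hpos _ hv]
  exact (pow_le_pow_iff_left₀ (norm_nonneg _) hε.le two_ne_zero).1 (hlt.trans hηε).le

/-- **Theorem 2.5 (continuous dependence on initial conditions).**
Under the growth condition and the Osgood condition on `b`, the (unique)
global solution flow `X : ℝ^d → [0,∞) → ℝ^d` of `X' = b(X)`, `X(0) = x₀`
satisfies: for every `x₀`, `t ≥ 0`, `ε > 0` there is `δ > 0` such that
`|y₀ − x₀| < δ` implies `sup_{0 ≤ s ≤ t} |X_s(y₀) − X_s(x₀)| ≤ ε`; in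
particular `x₀ ↦ X_t(x₀)` is continuous for each `t ≥ 0`. -/
theorem ode_flow_continuous_dependence
    (d : ℕ) (b : EuclideanSpace ℝ (Fin d) → EuclideanSpace ℝ (Fin d))
    (hb : Continuous b)
    -- growth condition
    (C : ℝ) (hC : 0 < C)
    (r₁ : ℝ → ℝ)
    (hr₁_cont : ContinuousOn r₁ (Set.Ici 0))
    (hr₁_nonneg : ∀ s, 0 ≤ s → 0 ≤ r₁ s)
    (hr₁_tendsto : Filter.Tendsto r₁ Filter.atTop Filter.atTop)
    (hr₁_int : ∫⁻ s in Set.Ioi (0:ℝ), ENNReal.ofReal (1 / (s * r₁ s + 1)) = ⊤)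
    (hgrowth : ∀ x, ‖b x‖ ≤ C * (‖x‖ * r₁ (‖x‖ ^ 2) + 1))
    -- Osgood condition
    (C' : ℝ) (hC' : 0 < C')
    (r : ℝ → ℝ)
    (hr_cont : ContinuousOn r (Set.Ioo 0 1))
    (hr_nonneg : ∀ s ∈ Set.Ioo (0:ℝ) 1, 0 ≤ r s)
    (hr_tendsto : Filter.Tendsto r (nhdsWithin 0 (Set.Ioi 0)) Filter.atTop)
    (hr_int : ∀ a ∈ Set.Ioo (0:ℝ) 1,
      ∫⁻ s in Set.Ioo (0:ℝ) a, ENNReal.ofReal (1 / (s * r s)) = ⊤)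
    (hosgood : ∀ x y : EuclideanSpace ℝ (Fin d), 0 < ‖x - y‖ → ‖x - y‖ < 1 →
      ‖b x - b y‖ ≤ C' * (‖x - y‖ * r (‖x - y‖ ^ 2)))
    -- the global solution flow
    (X : EuclideanSpace ℝ (Fin d) → ℝ → EuclideanSpace ℝ (Fin d))
    (hX0 : ∀ x₀, X x₀ 0 = x₀)
    (hX : ∀ x₀, ∀ t ∈ Set.Ici (0:ℝ),
      HasDerivWithinAt (X x₀) (b (X x₀ t)) (Set.Ici 0) t) :
    (∀ (x₀ : EuclideanSpace ℝ (Fin d)) (t : ℝ), 0 ≤ t → ∀ ε : ℝ, 0 < ε →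
      ∃ δ : ℝ, 0 < δ ∧ ∀ y₀ : EuclideanSpace ℝ (Fin d), ‖y₀ - x₀‖ < δ →
        ∀ s : ℝ, 0 ≤ s → s ≤ t → ‖X y₀ s - X x₀ s‖ ≤ ε) ∧
    (∀ t : ℝ, 0 ≤ t → Continuous fun x₀ => X x₀ t) := by
  have key : ∀ (x₀ : EuclideanSpace ℝ (Fin d)) (t : ℝ), 0 ≤ t → ∀ ε : ℝ, 0 < ε →
      ∃ δ : ℝ, 0 < δ ∧ ∀ y₀ : EuclideanSpace ℝ (Fin d), ‖y₀ - x₀‖ < δ →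
        ∀ s : ℝ, 0 ≤ s → s ≤ t → ‖X y₀ s - X x₀ s‖ ≤ ε := by
    intro x₀ t ht ε hε
    obtain ⟨δ, hδ, h⟩ :=
      exists_forall_norm_sub_le_of_osgood hC' hr_cont hr_tendsto hr_int hosgood ht hε
    exact ⟨δ, hδ, fun y₀ hy s hs hst =>
      h (X y₀) (X x₀) (hX y₀) (hX x₀) (by simpa [hX0] using hy) s ⟨hs, hst⟩⟩
  refine ⟨key, fun t ht => Metric.continuous_iff.2 fun x₀ ε hε => ?_⟩
  obtain ⟨δ, hδ, h⟩ := key x₀ t ht (ε / 2) (half_pos hε)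
  refine ⟨δ, hδ, fun y₀ hy => ?_⟩
  rw [dist_eq_norm] at hy ⊢
  exact (h y₀ hy t ht le_rfl).trans_lt (half_lt_self hε)
end

section
/- If x₀ ≠ y₀, then X_t(x₀) ≠ X_t(y₀) for all t ≥ 0 (non-confluence of the flow). -/
open Set Filter MeasureTheory

/-- A positive function `g` satisfying `g' ≥ -K * φ g` can only tend to `0` in finite time if
`1 / φ` is integrable near `0`. -/
theorem lintegral_one_div_ne_top_of_tendsto_zero {φ g g' : ℝ → ℝ} {a K t₀ T : ℝ}
    (hT : t₀ < T) (hφ : ContinuousOn φ (Ioc 0 a)) (hφ_pos : ∀ s ∈ Ioc 0 a, 0 < φ s)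
    (hg_mem : ∀ t ∈ Ioo t₀ T, g t ∈ Ioo 0 a)
    (hg : ∀ t ∈ Ioo t₀ T, HasDerivAt g (g' t) t)
    (hg' : ∀ t ∈ Ioo t₀ T, -g' t ≤ K * φ (g t))
    (hlim : Tendsto g (nhdsWithin T (Iio T)) (nhds 0)) :
    ∫⁻ s in Ioo 0 a, ENNReal.ofReal (1 / φ s) ≠ ⊤ := by
  set f : ℝ → ℝ := fun s => 1 / φ s with hf
  have hfc : ContinuousOn f (Ioc 0 a) :=
    continuousOn_const.div hφ fun s hs => (hφ_pos s hs).ne'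
  have hf_pos : ∀ s ∈ Ioc 0 a, 0 < f s := fun s hs => one_div_pos.2 (hφ_pos s hs)
  have hfi : ∀ c, 0 < c → IntegrableOn f (Icc c a) := fun c hc =>
    (hfc.mono fun s hs => ⟨hc.trans_le hs.1, hs.2⟩).integrableOn_Icc
  have hderiv : ∀ t ∈ Ioo t₀ T,
      HasDerivAt (fun t => (∫ s in (g t)..a, f s) - K * t) (-f (g t) * g' t - K) t := by
    intro t ht
    obtain ⟨h0, ha⟩ := hg_mem t ht
    have hnhds : Ioo 0 a ∈ nhds (g t) := Ioo_mem_nhds h0 ha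
    have hcont : ContinuousOn f (Ioo 0 a) := hfc.mono Ioo_subset_Ioc_self
    have hint : IntervalIntegrable f volume (g t) a :=
      (intervalIntegrable_iff_integrableOn_Icc_of_le ha.le).2 (hfi _ h0)
    have h1 := intervalIntegral.integral_hasDerivAt_left hint
      (hcont.stronglyMeasurableAtFilter isOpen_Ioo _ ⟨h0, ha⟩) (hcont.continuousAt hnhds)
    have h2 := h1.comp t (hg t ht)
    exact h2.sub (by simpa using (hasDerivAt_id t).const_mul K)
  have hanti : AntitoneOn (fun t => (∫ s in (g t)..a, f s) - K * t) (Ioo t₀ T) := by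
    refine antitoneOn_of_deriv_nonpos (convex_Ioo _ _)
      (fun t ht => (hderiv t ht).continuousAt.continuousWithinAt) ?_ ?_
    · rw [interior_Ioo]
      exact fun t ht => (hderiv t ht).differentiableAt.differentiableWithinAt
    · rw [interior_Ioo]
      intro t ht
      rw [(hderiv t ht).deriv]
      have hpos := hφ_pos _ (Ioo_subset_Ioc_self (hg_mem t ht))
      have : f (g t) * -g' t ≤ K := by
        rw [hf, one_div_mul_eq_div, div_le_iff₀ hpos]
        exact hg' t ht
      linarith
  obtain ⟨u, -, hu_mem, hu⟩ := exists_seq_strictMono_tendsto' hT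
  have hu_lim : Tendsto u atTop (nhdsWithin T (Iio T)) :=
    tendsto_nhdsWithin_iff.2 ⟨hu, Eventually.of_forall fun n => (hu_mem n).2⟩
  obtain ⟨m, hm⟩ := exists_between hT
  have hIoc : IntegrableOn f (Ioc 0 a) := by
    refine integrableOn_Ioc_of_intervalIntegral_norm_bounded_left (l := atTop)
      (I := (∫ s in (g m)..a, f s) - K * m + |K| * (|t₀| + |T|)) (a := fun n => g (u n))
      (fun n => (hfi _ (hg_mem _ (hu_mem n)).1).mono_set Ioc_subset_Icc_self)
      (hlim.comp hu_lim) ?_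
    filter_upwards [hu.eventually (lt_mem_nhds hm.2)] with n hn
    obtain ⟨h0, ha⟩ := hg_mem _ (hu_mem n)
    have hnorm : ∫ s in Ioc (g (u n)) a, ‖f s‖ = ∫ s in (g (u n))..a, f s := by
      rw [intervalIntegral.integral_of_le ha.le]
      exact setIntegral_congr_fun measurableSet_Ioc fun s hs =>
        Real.norm_of_nonneg (hf_pos s ⟨h0.trans hs.1, hs.2⟩).le
    have hle := hanti hm (hu_mem n) hn.le
    have hKu : K * u n ≤ |K| * (|t₀| + |T|) := by
      refine (le_abs_self _).trans ?_
      rw [abs_mul]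
      refine mul_le_mul_of_nonneg_left (abs_le.2 ⟨?_, ?_⟩) (abs_nonneg K)
      · linarith [neg_abs_le t₀, abs_nonneg T, (hu_mem n).1]
      · linarith [le_abs_self T, abs_nonneg t₀, (hu_mem n).2]
    dsimp only at hle
    linarith
  exact (hIoc.mono_set Ioo_subset_Ioc_self).lintegral_lt_top.ne

/-- **Proposition 2.6 (non-confluence).**
Under the growth condition and the Osgood condition on `b`, the global
solution flow `X` of `X' = b(X)` satisfies: if `x₀ ≠ y₀`, then
`X_t(x₀) ≠ X_t(y₀)` for all `t ≥ 0`. -/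
theorem ode_flow_non_confluence
    (d : ℕ) (b : EuclideanSpace ℝ (Fin d) → EuclideanSpace ℝ (Fin d))
    (hb : Continuous b)
    -- growth condition
    (C : ℝ) (hC : 0 < C)
    (r₁ : ℝ → ℝ)
    (hr₁_cont : ContinuousOn r₁ (Set.Ici 0))
    (hr₁_nonneg : ∀ s, 0 ≤ s → 0 ≤ r₁ s)
    (hr₁_tendsto : Filter.Tendsto r₁ Filter.atTop Filter.atTop)
    (hr₁_int : ∫⁻ s in Set.Ioi (0:ℝ), ENNReal.ofReal (1 / (s * r₁ s + 1)) = ⊤)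
    (hgrowth : ∀ x, ‖b x‖ ≤ C * (‖x‖ * r₁ (‖x‖ ^ 2) + 1))
    -- Osgood condition
    (C' : ℝ) (hC' : 0 < C')
    (r : ℝ → ℝ)
    (hr_cont : ContinuousOn r (Set.Ioo 0 1))
    (hr_nonneg : ∀ s ∈ Set.Ioo (0:ℝ) 1, 0 ≤ r s)
    (hr_tendsto : Filter.Tendsto r (nhdsWithin 0 (Set.Ioi 0)) Filter.atTop)
    (hr_int : ∀ a ∈ Set.Ioo (0:ℝ) 1,
      ∫⁻ s in Set.Ioo (0:ℝ) a, ENNReal.ofReal (1 / (s * r s)) = ⊤)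
    (hosgood : ∀ x y : EuclideanSpace ℝ (Fin d), 0 < ‖x - y‖ → ‖x - y‖ < 1 →
      ‖b x - b y‖ ≤ C' * (‖x - y‖ * r (‖x - y‖ ^ 2)))
    -- the global solution flow
    (X : EuclideanSpace ℝ (Fin d) → ℝ → EuclideanSpace ℝ (Fin d))
    (hX0 : ∀ x₀, X x₀ 0 = x₀)
    (hX : ∀ x₀, ∀ t ∈ Set.Ici (0:ℝ),
      HasDerivWithinAt (X x₀) (b (X x₀ t)) (Set.Ici 0) t) :
    ∀ x₀ y₀ : EuclideanSpace ℝ (Fin d), x₀ ≠ y₀ →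
      ∀ t : ℝ, 0 ≤ t → X x₀ t ≠ X y₀ t := by
  intro x₀ y₀ hne t₁ ht₁ heq
  set w : ℝ → EuclideanSpace ℝ (Fin d) := fun t => X x₀ t - X y₀ t with hw
  have hw_cont : ContinuousOn w (Ici 0) := fun t ht =>
    ((hX x₀ t ht).sub (hX y₀ t ht)).continuousWithinAt
  have hZ_ne : (Ici 0 ∩ w ⁻¹' {0}).Nonempty := ⟨t₁, ht₁, by simp [hw, heq]⟩
  have hZ_bdd : BddBelow (Ici 0 ∩ w ⁻¹' {0}) := ⟨0, fun t ht => ht.1⟩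
  obtain ⟨T, hT⟩ : ∃ T, T = sInf (Ici 0 ∩ w ⁻¹' {0}) := ⟨_, rfl⟩
  have hTmem : T ∈ Ici 0 ∩ w ⁻¹' {0} := hT ▸
    (hw_cont.preimage_isClosed_of_isClosed isClosed_Ici isClosed_singleton).csInf_mem hZ_ne hZ_bdd
  have hwT : w T = 0 := hTmem.2
  have hT_pos : 0 < T := by
    refine lt_of_le_of_ne hTmem.1 fun h => hne ?_
    rw [← h] at hwT
    simpa [hw, hX0, sub_eq_zero] using hwT
  have hw_ne : ∀ t ∈ Ico 0 T, w t ≠ 0 := fun t ht h =>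
    ht.2.not_ge (hT ▸ csInf_le hZ_bdd ⟨ht.1, h⟩)
  obtain ⟨a, ha_pos, ha⟩ : ∃ a > 0, ∀ s ∈ Ioo 0 a, 0 < r s := by
    have := hr_tendsto.eventually (eventually_gt_atTop 0)
    obtain ⟨a, ha, h⟩ := mem_nhdsGT_iff_exists_Ioo_subset.1 this
    exact ⟨a, ha, h⟩
  set c := min a 1 / 2 with hc
  have hmin : 0 < min a 1 := lt_min ha_pos one_pos
  have hc_pos : 0 < c := by positivity
  have hca : c < a := (half_lt_self hmin).trans_le (min_le_left _ _)
  have hc1 : c < 1 := (half_lt_self hmin).trans_le (min_le_right _ _)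
  have hw_at : ContinuousAt w T := hw_cont.continuousAt (Ici_mem_nhds hT_pos)
  have hlim : Tendsto (fun t => ‖w t‖ ^ 2) (nhds T) (nhds 0) := by
    have := hw_at.norm.tendsto.pow 2
    simpa [hwT] using this
  obtain ⟨l, hlT, hl⟩ : ∃ l < T, ∀ t ∈ Ioc l T, ‖w t‖ ^ 2 < c :=
    exists_Ioc_subset_of_mem_nhds (hlim.eventually (gt_mem_nhds hc_pos)) ⟨0, hT_pos⟩
  have hw_pos : ∀ t ∈ Ioo (max l 0) T, 0 < ‖w t‖ := fun t ht =>
    norm_pos_iff.2 (hw_ne t ⟨(le_max_right l 0).trans ht.1.le, ht.2⟩)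
  have hmem : ∀ t ∈ Ioo (max l 0) T, ‖w t‖ ^ 2 ∈ Ioo 0 c := fun t ht =>
    ⟨pow_pos (hw_pos t ht) 2,
      hl t ⟨(le_max_left l 0).trans_lt ht.1, ht.2.le⟩⟩
  refine lintegral_one_div_ne_top_of_tendsto_zero (φ := fun s => s * r s)
    (g := fun t => ‖w t‖ ^ 2) (g' := fun t => 2 * inner ℝ (w t) (b (X x₀ t) - b (X y₀ t)))
    (K := 2 * C') (max_lt hlT hT_pos) ?_ ?_ hmem ?_ ?_
    (hlim.mono_left nhdsWithin_le_nhds) (hr_int c ⟨hc_pos, hc1⟩)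
  · exact continuousOn_id.mul (hr_cont.mono fun s hs => ⟨hs.1, hs.2.trans_lt hc1⟩)
  · exact fun s hs => mul_pos hs.1 (ha s ⟨hs.1, hs.2.trans_lt hca⟩)
  · intro t ht
    have ht0 : 0 < t := (le_max_right l 0).trans_lt ht.1
    have hnhds := Ici_mem_nhds ht0
    exact (((hX x₀ t ht0.le).hasDerivAt hnhds).sub ((hX y₀ t ht0.le).hasDerivAt hnhds)).norm_sq
  · intro t ht
    obtain ⟨-, h1⟩ := hmem t ht
    have hw0 : 0 < ‖w t‖ := hw_pos t ht
    have hw1 : ‖w t‖ < 1 := (sq_lt_one_iff₀ (norm_nonneg _)).1 (h1.trans hc1)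
    have hb_le : ‖b (X x₀ t) - b (X y₀ t)‖ ≤ C' * (‖w t‖ * r (‖w t‖ ^ 2)) :=
      hosgood _ _ hw0 hw1
    have hinner := neg_le_of_abs_le
      (abs_real_inner_le_norm (w t) (b (X x₀ t) - b (X y₀ t)))
    have hmul := mul_le_mul_of_nonneg_left hb_le hw0.le
    linarith
end

section
/- For every t ≥ 0, the map x₀ ↦ X_t(x₀) is a homeomorphism of ℝ^d onto itself. -/
open Set Filter MeasureTheory

/-- If `ξ' ≤ K * g ξ` as long as `ξ ∈ [α, β]`, and crossing `[α, β]` at speed `K * g` takes longer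
than `T`, then `ξ` starting below `α` stays below `β` up to time `T`. -/
theorem lt_of_deriv_le_of_lintegral_gt {g ξ ξ' : ℝ → ℝ} {α β K T : ℝ} (hαβ : α ≤ β)
    (hK : 0 ≤ K) (hT : 0 ≤ T) (hg : ContinuousOn g (Icc α β)) (hgpos : ∀ s ∈ Icc α β, 0 < g s)
    (hint : ENNReal.ofReal (K * T) < ∫⁻ s in Icc α β, ENNReal.ofReal (1 / g s))
    (hξ : ∀ t ∈ Icc 0 T, HasDerivWithinAt ξ (ξ' t) (Icc 0 T) t) (h0 : ξ 0 ≤ α)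
    (hbound : ∀ t ∈ Icc 0 T, ξ t ∈ Icc α β → ξ' t ≤ K * g (ξ t)) :
    ∀ t ∈ Icc 0 T, ξ t < β := by
  set f : ℝ → ℝ := IccExtend hαβ ((Icc α β).domRestrict fun s ↦ 1 / g s) with hf
  have hf_eq : ∀ s ∈ Icc α β, f s = 1 / g s := fun s hs ↦ by
    simp [hf, IccExtend_of_mem hαβ _ hs]
  have hf_cont : Continuous f :=
    (continuousOn_iff_continuous_domRestrict.1
      (continuousOn_const.div hg fun s hs ↦ (hgpos s hs).ne')).Icc_extend'
  have hf_pos : ∀ s, 0 < f s := fun s ↦ by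
    simp only [hf, IccExtend, Function.comp, domRestrict_apply]
    exact one_div_pos.2 (hgpos _ (projIcc α β hαβ s).2)
  set G : ℝ → ℝ := fun u ↦ ∫ s in α..u, f s with hG
  have hG' : ∀ u, HasDerivAt G (f u) u := fun u ↦
    intervalIntegral.integral_hasDerivAt_right (hf_cont.intervalIntegrable _ _)
      (hf_cont.stronglyMeasurableAtFilter _ _) hf_cont.continuousAt
  have hGmono : StrictMono G := strictMono_of_hasDerivAt_pos hG' hf_pos
  have hGα : G α = 0 := by simp [hG]
  have hGβ : K * T < G β := by
    have : ∫⁻ s in Icc α β, ENNReal.ofReal (1 / g s) = ENNReal.ofReal (G β) := by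
      rw [hG]
      simp only
      rw [intervalIntegral.integral_of_le hαβ, ← integral_Icc_eq_integral_Ioc,
        ofReal_integral_eq_lintegral_ofReal hf_cont.continuousOn.integrableOn_Icc
          (.of_forall fun s ↦ (hf_pos s).le)]
      exact setLIntegral_congr_fun measurableSet_Icc fun s hs ↦ by simp only [hf_eq s hs]
    rw [this] at hint
    exact (ENNReal.ofReal_lt_ofReal_iff_of_nonneg (by positivity)).1 hint
  obtain ⟨K', hKK', hK'⟩ : ∃ K', K < K' ∧ K' * T < G β := by
    refine ⟨K + (G β - K * T) / (2 * (T + 1)), ?_, ?_⟩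
    · have : 0 < (G β - K * T) / (2 * (T + 1)) := div_pos (by linarith) (by linarith)
      linarith
    · have h1 : (G β - K * T) / (2 * (T + 1)) * T < G β - K * T := by
        rw [div_mul_eq_mul_div, div_lt_iff₀ (by linarith)]
        nlinarith
      linarith
  have key : ∀ ⦃t⦄, t ∈ Icc 0 T → (G ∘ ξ) t ≤ K' * t := by
    refine image_le_of_deriv_right_lt_deriv_boundary (f' := fun t ↦ f (ξ t) * ξ' t)
      (B' := fun _ ↦ K') ?_ ?_ ?_ ?_ ?_
    · intro t ht
      exact ((hG' _).comp_hasDerivWithinAt t (hξ t ht)).continuousWithinAt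
    · intro t ht
      refine ((hG' _).comp_hasDerivWithinAt t (hξ t (Ico_subset_Icc_self ht))).mono_of_mem_nhdsWithin
        (Icc_mem_nhdsGE_of_mem ht)
    · simpa [hGα] using hGmono.monotone h0
    · intro t
      simpa using (hasDerivAt_id t).const_mul K'
    · intro t ht heq
      have hmem : ξ t ∈ Icc α β := by
        constructor
        · refine hGmono.le_iff_le.1 ?_
          rw [hGα]
          exact (mul_nonneg (hK.trans hKK'.le) ht.1).trans_eq heq.symm
        · refine hGmono.le_iff_le.1 ?_
          have : G (ξ t) = K' * t := heq
          rw [this]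
          nlinarith [ht.2]
      have h1 := hbound t (Ico_subset_Icc_self ht) hmem
      rw [hf_eq _ hmem, one_div, inv_mul_eq_div]
      exact ((div_le_iff₀ (hgpos _ hmem)).2 h1).trans_lt hKK'
  intro t ht
  refine hGmono.lt_iff_lt.1 ((key ht).trans_lt (lt_of_le_of_lt ?_ hK'))
  exact mul_le_mul_of_nonneg_left ht.2 (hK.trans hKK'.le)

/-- Under an Osgood modulus of continuity, approximate solutions depend continuously on the initial
value and on the error in the equation. -/
theorem osgood_stability {E : Type*} [NormedAddCommGroup E] [InnerProductSpace ℝ E] {c : E → E}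
    {C : ℝ} (hC : 0 < C) {r : ℝ → ℝ} (hr_cont : ContinuousOn r (Ioo 0 1))
    (hr_tendsto : Tendsto r (nhdsWithin 0 (Ioi 0)) atTop)
    (hr_int : ∀ a ∈ Ioo (0 : ℝ) 1, ∫⁻ s in Ioo (0 : ℝ) a, ENNReal.ofReal (1 / (s * r s)) = ⊤)
    (hosgood : ∀ x y : E, 0 < ‖x - y‖ → ‖x - y‖ < 1 →
      ‖c x - c y‖ ≤ C * (‖x - y‖ * r (‖x - y‖ ^ 2)))
    {T : ℝ} (hT : 0 ≤ T) {η : ℝ} (hη : 0 < η) :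
    ∃ δ > 0, ∀ u v u' v' : ℝ → E,
      (∀ t ∈ Icc 0 T, HasDerivWithinAt u (u' t) (Icc 0 T) t) →
      (∀ t ∈ Icc 0 T, HasDerivWithinAt v (v' t) (Icc 0 T) t) →
      (∀ t ∈ Icc 0 T, ‖u' t - v' t - (c (u t) - c (v t))‖ ≤ δ) →
      ‖u 0 - v 0‖ ≤ δ → ‖u T - v T‖ < η := by
  obtain ⟨ε, hε, hrε⟩ : ∃ ε > 0, ∀ s ∈ Ioo 0 ε, 1 ≤ r s := by
    obtain ⟨ε, hε, h⟩ := mem_nhdsGT_iff_exists_Ioo_subset.1 (hr_tendsto.eventually_ge_atTop 1)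
    exact ⟨ε, hε, h⟩
  obtain ⟨β, hβ0, hβη, hβε, hβ1⟩ : ∃ β > 0, β ≤ η ^ 2 ∧ β < ε ∧ β < 1 := by
    refine ⟨min (η ^ 2) (min (ε / 2) (1 / 2)), by positivity,
      min_le_left _ _, ?_, ?_⟩
    · have := (min_le_right (η ^ 2) _).trans (min_le_left (ε / 2) (1 / 2))
      linarith
    · have := (min_le_right (η ^ 2) _).trans (min_le_right (ε / 2) (1 / 2))
      linarith
  have hcont : ContinuousOn (fun s ↦ s * r s) (Ioo 0 1) := continuousOn_id.mul hr_cont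
  have hpos : ∀ s ∈ Ioc 0 β, s ≤ s * r s := fun s hs ↦
    le_mul_of_one_le_right hs.1.le (hrε s ⟨hs.1, hs.2.trans_lt hβε⟩)
  obtain ⟨α, hα, hαint⟩ : ∃ α ∈ Ioo 0 β,
      ENNReal.ofReal (3 * C * T) < ∫⁻ s in Icc α β, ENNReal.ofReal (1 / (s * r s)) := by
    have hcov : AECover (volume.restrict (Ioo 0 β)) (nhdsWithin 0 (Ioi 0)) fun a ↦ Icc a β :=
      aecover_Ioo_of_Icc (tendsto_nhdsWithin_of_tendsto_nhds tendsto_id) tendsto_const_nhds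
    have hm : AEMeasurable (fun s ↦ ENNReal.ofReal (1 / (s * r s))) (volume.restrict (Ioo 0 β)) := by
      refine AEMeasurable.ennreal_ofReal (ContinuousOn.aemeasurable ?_ measurableSet_Ioo)
      exact continuousOn_const.div (hcont.mono (Ioo_subset_Ioo_right hβ1.le))
        fun s hs ↦ (hs.1.trans_le (hpos s (Ioo_subset_Ioc_self hs))).ne'
    have := hcov.lintegral_tendsto_of_countably_generated hm
    rw [hr_int β ⟨hβ0, hβ1⟩] at this
    obtain ⟨α, h1, h2⟩ := ((this.eventually (eventually_gt_nhds ENNReal.ofReal_lt_top)).and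
      (Ioo_mem_nhdsGT hβ0)).exists
    refine ⟨α, h2, h1.trans_le (lintegral_mono' ?_ le_rfl)⟩
    exact Measure.restrict_mono le_rfl Measure.restrict_le_self
  have hδ : ∃ δ > 0, 2 * δ ≤ C * α ∧ δ ^ 2 ≤ α := by
    refine ⟨min (C * α / 2) (min α 1), ?_, ?_, ?_⟩
    · have := hα.1; positivity
    · linarith [min_le_left (C * α / 2) (min α 1)]
    · have h1 := (min_le_right (C * α / 2) _).trans (min_le_left α 1)
      have h2 := (min_le_right (C * α / 2) _).trans (min_le_right α 1)
      have h3 : 0 < min (C * α / 2) (min α 1) := by have := hα.1; positivity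
      nlinarith
  obtain ⟨δ, hδ0, hδα, hδ2⟩ := hδ
  refine ⟨δ, hδ0, fun u v u' v' hu hv herr h0 ↦ ?_⟩
  have hsub : Icc α β ⊆ Ioo 0 1 := fun s hs ↦ ⟨hα.1.trans_le hs.1, hs.2.trans_lt hβ1⟩
  have := lt_of_deriv_le_of_lintegral_gt (g := fun s ↦ s * r s) (ξ := fun t ↦ ‖u t - v t‖ ^ 2)
    hα.2.le (by positivity) hT (hcont.mono hsub)
    (fun s hs ↦ (hsub hs).1.trans_le (hpos s ⟨(hsub hs).1, hs.2⟩)) hαint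
    (fun t ht ↦ ((hu t ht).sub (hv t ht)).norm_sq)
    ((pow_le_pow_left₀ (norm_nonneg _) h0 2).trans hδ2) ?_ T ⟨hT, le_rfl⟩
  · exact lt_of_pow_lt_pow_left₀ 2 hη.le (this.trans_le hβη)
  · intro t ht hmem
    set ρ := ‖u t - v t‖ with hρ
    have hρ2 := hsub hmem
    have hρ0 : 0 < ρ := by
      refine (norm_nonneg _).lt_of_ne fun h ↦ ?_
      rw [← hρ] at h
      simp [← h] at hρ2
    have hρ1 : ρ < 1 := (sq_lt_one_iff₀ hρ0.le).1 hρ2.2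
    have h1 := hosgood (u t) (v t) hρ0 hρ1
    rw [← hρ] at h1
    have h2 := herr t ht
    have h3 : ‖u' t - v' t‖ ≤ C * (ρ * r (ρ ^ 2)) + δ := by
      calc ‖u' t - v' t‖ = ‖(c (u t) - c (v t)) + (u' t - v' t - (c (u t) - c (v t)))‖ := by
            congr 1; abel
        _ ≤ _ := (norm_add_le _ _).trans (add_le_add h1 h2)
    have h4 : inner ℝ (u t - v t) (u' t - v' t) ≤ ρ * (C * (ρ * r (ρ ^ 2)) + δ) :=
      (real_inner_le_norm _ _).trans (mul_le_mul_of_nonneg_left h3 hρ0.le)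
    have h5 : ρ ^ 2 ≤ ρ ^ 2 * r (ρ ^ 2) := hpos _ ⟨hρ2.1, hmem.2⟩
    have h6 : C * α ≤ C * (ρ ^ 2 * r (ρ ^ 2)) :=
      mul_le_mul_of_nonneg_left (hmem.1.trans h5) hC.le
    have h7 : ρ * δ ≤ δ := mul_le_of_le_one_left hδ0.le hρ1.le
    have h8 : ρ * (C * (ρ * r (ρ ^ 2)) + δ) = C * (ρ ^ 2 * r (ρ ^ 2)) + ρ * δ := by ring
    change 2 * inner ℝ (u t - v t) (u' t - v' t) ≤ _
    linarith

/-- Under the integral growth condition, curves whose speed obeys the growth bound stay in a ball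
depending only on the starting point and the time horizon. -/
theorem exists_norm_lt_of_growth {E : Type*} [NormedAddCommGroup E] [InnerProductSpace ℝ E]
    {C : ℝ} (hC : 0 < C) {r : ℝ → ℝ} (hr_cont : ContinuousOn r (Ici 0))
    (hr_nonneg : ∀ s, 0 ≤ s → 0 ≤ r s) (hr_tendsto : Tendsto r atTop atTop)
    (hr_int : ∫⁻ s in Ioi (0 : ℝ), ENNReal.ofReal (1 / (s * r s + 1)) = ⊤)
    {T : ℝ} (hT : 0 ≤ T) (y : E) :
    ∃ R > 0, ∀ u u' : ℝ → E, (∀ t ∈ Icc 0 T, HasDerivWithinAt u (u' t) (Icc 0 T) t) →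
      (∀ t ∈ Icc 0 T, ‖u' t‖ ≤ C * (‖u t‖ * r (‖u t‖ ^ 2) + 1)) → u 0 = y →
      ∀ t ∈ Icc 0 T, ‖u t‖ < R := by
  obtain ⟨S, hS1, hS⟩ : ∃ S ≥ 1, ∀ s ≥ S, 1 ≤ r s := by
    obtain ⟨S, hS⟩ := eventually_atTop.1 (hr_tendsto.eventually_ge_atTop 1)
    exact ⟨max S 1, le_max_right _ _, fun s hs ↦ hS s ((le_max_left _ _).trans hs)⟩
  have hge : ∀ s, 0 ≤ s → 1 ≤ s * r s + 1 := fun s hs ↦ by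
    linarith [mul_nonneg hs (hr_nonneg s hs)]
  have hcont : ContinuousOn (fun s ↦ s * r s + 1) (Ici 0) :=
    (continuousOn_id.mul hr_cont).add continuousOn_const
  set α := ‖y‖ ^ 2 with hα
  have hα0 : 0 ≤ α := by positivity
  set K := 2 * C * (1 + S) with hK
  obtain ⟨β, hβ, hβint⟩ : ∃ β > α,
      ENNReal.ofReal (K * T) < ∫⁻ s in Icc α β, ENNReal.ofReal (1 / (s * r s + 1)) := by
    have htop : ∫⁻ s in Ici α, ENNReal.ofReal (1 / (s * r s + 1)) = ⊤ := by
      have h1 : ∫⁻ s in Ioc 0 α, ENNReal.ofReal (1 / (s * r s + 1)) < ⊤ := by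
        refine (setLIntegral_mono measurable_one fun s hs ↦ ?_).trans_lt
          (?_ : ∫⁻ s in Ioc 0 α, 1 < ⊤)
        · refine ENNReal.ofReal_le_one.2 ((div_le_one ?_).2 (hge s hs.1.le))
          linarith [hge s hs.1.le]
        · simp
      have h2 := (hr_int.symm.le.trans (lintegral_mono_set (t := Ioc 0 α ∪ Ici α) fun s hs ↦
        (le_total s α).imp (fun h ↦ ⟨hs, h⟩) id)).trans (lintegral_union_le _ _ _)
      by_contra h
      exact (ENNReal.add_lt_top.2 ⟨h1, lt_top_iff_ne_top.2 h⟩).not_ge h2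
    have hcov : AECover (volume.restrict (Ici α)) atTop fun b ↦ Ico α b :=
      aecover_Ici_of_Ico tendsto_id
    have hm : AEMeasurable (fun s ↦ ENNReal.ofReal (1 / (s * r s + 1)))
        (volume.restrict (Ici α)) := by
      refine AEMeasurable.ennreal_ofReal (ContinuousOn.aemeasurable ?_ measurableSet_Ici)
      refine continuousOn_const.div (hcont.mono (Ici_subset_Ici.2 hα0)) fun s hs ↦ ?_
      linarith [hge s (hα0.trans hs)]
    have := hcov.lintegral_tendsto_of_countably_generated hm
    rw [htop] at this
    obtain ⟨β, h1, h2⟩ := ((this.eventually (eventually_gt_nhds ENNReal.ofReal_lt_top)).and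
      (eventually_gt_atTop α)).exists
    refine ⟨β, h2, h1.trans_le (lintegral_mono' ?_ le_rfl)⟩
    exact (Measure.restrict_mono le_rfl Measure.restrict_le_self).trans
      (Measure.restrict_mono Ico_subset_Icc_self le_rfl)
  have hβ0 : 0 < β := hα0.trans_lt hβ
  refine ⟨√β, Real.sqrt_pos.2 hβ0, fun u u' hu hbound h0 t ht ↦ ?_⟩
  have hsub : Icc α β ⊆ Ici 0 := fun s hs ↦ hα0.trans hs.1
  have := lt_of_deriv_le_of_lintegral_gt (g := fun s ↦ s * r s + 1) (ξ := fun t ↦ ‖u t‖ ^ 2)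
    hβ.le (by positivity) hT (hcont.mono hsub)
    (fun s hs ↦ zero_lt_one.trans_le (hge s (hsub hs))) hβint
    (fun t ht ↦ (hu t ht).norm_sq) (by simp [h0, hα]) ?_ t ht
  · exact Real.lt_sqrt_of_sq_lt this
  · intro t ht _
    set ρ := ‖u t‖ with hρ
    have hρ0 : 0 ≤ ρ := norm_nonneg _
    have h1 : inner ℝ (u t) (u' t) ≤ ρ * (C * (ρ * r (ρ ^ 2) + 1)) :=
      (real_inner_le_norm _ _).trans (mul_le_mul_of_nonneg_left (hbound t ht) hρ0)
    have h2 := hge (ρ ^ 2) (sq_nonneg _)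
    have h3 : ρ ≤ S * (ρ ^ 2 * r (ρ ^ 2) + 1) := by
      rcases le_total ρ S with h | h
      · nlinarith
      · have h4 := hS (ρ ^ 2) (by nlinarith)
        nlinarith [mul_le_mul_of_nonneg_left h4 (sq_nonneg ρ)]
    have h5 : ρ * (C * (ρ * r (ρ ^ 2) + 1)) = C * (ρ ^ 2 * r (ρ ^ 2) + ρ) := by ring
    have h6 : C * (ρ ^ 2 * r (ρ ^ 2) + ρ) ≤ C * ((1 + S) * (ρ ^ 2 * r (ρ ^ 2) + 1)) :=
      mul_le_mul_of_nonneg_left (by linarith) hC.le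
    rw [hK]
    linarith

/-- A continuous vector field can be approximated on a ball by a compactly supported smooth one
whose norm is nowhere larger up to `1`. -/
theorem exists_contDiff_hasCompactSupport_approx {E : Type*} [NormedAddCommGroup E]
    [InnerProductSpace ℝ E] [FiniteDimensional ℝ E] {b : E → E} (hb : Continuous b) {R ε : ℝ}
    (hR : 0 < R) (hε : 0 < ε) (hε1 : ε ≤ 1) :
    ∃ h : E → E, ContDiff ℝ 1 h ∧ HasCompactSupport h ∧ (∀ x, ‖h x‖ ≤ ‖b x‖ + 1) ∧
      ∀ x, ‖x‖ ≤ R → ‖h x - b x‖ ≤ ε := by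
  let χ : ContDiffBump (0 : E) := ⟨R, R + 1, hR, by linarith⟩
  obtain ⟨h, h1, h2, h3⟩ := Continuous.exists_contDiff_approx (f := fun x ↦ χ x • b x)
    (ε := fun _ ↦ ε) 1 (χ.continuous.smul hb) continuous_const fun _ ↦ hε
  refine ⟨h, h1, ?_, fun x ↦ ?_, fun x hx ↦ ?_⟩
  · exact χ.hasCompactSupport.smul_right.mono h3
  · have h4 := h2 x
    rw [dist_eq_norm] at h4
    have h5 : ‖χ x • b x‖ ≤ ‖b x‖ := by
      rw [norm_smul, Real.norm_of_nonneg χ.nonneg]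
      exact mul_le_of_le_one_left (norm_nonneg _) χ.le_one
    linarith [norm_le_norm_add_norm_sub' (h x) (χ x • b x)]
  · have h4 := h2 x
    rw [dist_eq_norm, χ.one_of_mem_closedBall (by simpa using hx), one_smul] at h4
    exact h4.le

/-- A compactly supported `C¹` vector field has integral curves on every interval `[0, T]`. -/
theorem exists_integralCurve_of_hasCompactSupport {E : Type*} [NormedAddCommGroup E]
    [InnerProductSpace ℝ E] [FiniteDimensional ℝ E] {h : E → E} (hh : ContDiff ℝ 1 h)
    (hc : HasCompactSupport h) (y : E) {T : ℝ} (hT : 0 ≤ T) :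
    ∃ u : ℝ → E, u 0 = y ∧ ∀ t ∈ Icc 0 T, HasDerivWithinAt u (h (u t)) (Icc 0 T) t := by
  obtain ⟨K, hK⟩ := hh.lipschitzWith_of_hasCompactSupport hc one_ne_zero
  obtain ⟨L, hL⟩ := hc.exists_bound_of_continuous hh.continuous
  have hPL : IsPicardLindelof (fun _ ↦ h) (⟨0, le_rfl, hT⟩ : Icc 0 T) y
      (L.toNNReal * T.toNNReal) 0 L.toNNReal K :=
    .of_time_independent (fun x _ ↦ (hL x).trans (Real.le_coe_toNNReal L)) hK.lipschitzOnWith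
      (by simp [hT])
  exact hPL.exists_eq_forall_mem_Icc_hasDerivWithinAt₀

/-- Time reversal of a curve on `[0, T]`. -/
theorem HasDerivWithinAt.comp_time_reversal {E : Type*} [NormedAddCommGroup E] [NormedSpace ℝ E]
    {u u' : ℝ → E} {T : ℝ} (hu : ∀ t ∈ Icc 0 T, HasDerivWithinAt u (u' t) (Icc 0 T) t) :
    ∀ t ∈ Icc 0 T, HasDerivWithinAt (fun s ↦ u (T - s)) (-u' (T - t)) (Icc 0 T) t := by
  intro t ht
  have hmaps : MapsTo (fun s ↦ T - s) (Icc 0 T) (Icc 0 T) := fun s hs ↦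
    ⟨by linarith [hs.2], by linarith [hs.1]⟩
  simpa using! (hu (T - t) (hmaps ht)).scomp t ((hasDerivWithinAt_id t _).const_sub T) hmaps

/-- **Theorem 2.7 (flow of homeomorphisms).**
Under the growth condition and the Osgood condition on `b`, for every
`t ≥ 0` the map `x₀ ↦ X_t(x₀)` given by the global solution flow of
`X' = b(X)`, `X(0) = x₀` is a homeomorphism of `ℝ^d` onto itself. -/
theorem ode_flow_homeomorphism
    (d : ℕ) (b : EuclideanSpace ℝ (Fin d) → EuclideanSpace ℝ (Fin d))
    (hb : Continuous b)
    -- growth condition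
    (C : ℝ) (hC : 0 < C)
    (r₁ : ℝ → ℝ)
    (hr₁_cont : ContinuousOn r₁ (Set.Ici 0))
    (hr₁_nonneg : ∀ s, 0 ≤ s → 0 ≤ r₁ s)
    (hr₁_tendsto : Filter.Tendsto r₁ Filter.atTop Filter.atTop)
    (hr₁_int : ∫⁻ s in Set.Ioi (0:ℝ), ENNReal.ofReal (1 / (s * r₁ s + 1)) = ⊤)
    (hgrowth : ∀ x, ‖b x‖ ≤ C * (‖x‖ * r₁ (‖x‖ ^ 2) + 1))
    -- Osgood condition
    (C' : ℝ) (hC' : 0 < C')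
    (r : ℝ → ℝ)
    (hr_cont : ContinuousOn r (Set.Ioo 0 1))
    (hr_nonneg : ∀ s ∈ Set.Ioo (0:ℝ) 1, 0 ≤ r s)
    (hr_tendsto : Filter.Tendsto r (nhdsWithin 0 (Set.Ioi 0)) Filter.atTop)
    (hr_int : ∀ a ∈ Set.Ioo (0:ℝ) 1,
      ∫⁻ s in Set.Ioo (0:ℝ) a, ENNReal.ofReal (1 / (s * r s)) = ⊤)
    (hosgood : ∀ x y : EuclideanSpace ℝ (Fin d), 0 < ‖x - y‖ → ‖x - y‖ < 1 →
      ‖b x - b y‖ ≤ C' * (‖x - y‖ * r (‖x - y‖ ^ 2)))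
    -- the global solution flow
    (X : EuclideanSpace ℝ (Fin d) → ℝ → EuclideanSpace ℝ (Fin d))
    (hX0 : ∀ x₀, X x₀ 0 = x₀)
    (hX : ∀ x₀, ∀ t ∈ Set.Ici (0:ℝ),
      HasDerivWithinAt (X x₀) (b (X x₀ t)) (Set.Ici 0) t) :
    ∀ t : ℝ, 0 ≤ t →
      ∃ h : EuclideanSpace ℝ (Fin d) ≃ₜ EuclideanSpace ℝ (Fin d),
        ∀ x₀, h x₀ = X x₀ t := by
  intro T hT
  have hX' : ∀ x, ∀ t ∈ Icc 0 T, HasDerivWithinAt (X x) (b (X x t)) (Icc 0 T) t := fun x t ht ↦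
    (hX x t ht.1).mono Icc_subset_Ici_self
  have hosgood_neg : ∀ x y : EuclideanSpace ℝ (Fin d), 0 < ‖x - y‖ → ‖x - y‖ < 1 →
      ‖-b x - -b y‖ ≤ C' * (‖x - y‖ * r (‖x - y‖ ^ 2)) := fun x y h0 h1 ↦ by
    rw [neg_sub_neg, norm_sub_rev]
    exact hosgood x y h0 h1
  have hcont : UniformContinuous fun x ↦ X x T := by
    refine Metric.uniformContinuous_iff.2 fun η hη ↦ ?_
    obtain ⟨δ, hδ, h⟩ := osgood_stability hC' hr_cont hr_tendsto hr_int hosgood hT hη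
    refine ⟨δ, hδ, fun x y hxy ↦ ?_⟩
    rw [dist_eq_norm] at hxy ⊢
    refine h _ _ _ _ (hX' x) (hX' y) (fun t _ ↦ by simpa using hδ.le) ?_
    simpa only [hX0] using hxy.le
  have hinv : ∀ η > 0, ∃ δ > 0, ∀ x y, dist (X x T) (X y T) < δ → dist x y < η := by
    intro η hη
    obtain ⟨δ, hδ, h⟩ := osgood_stability hC' hr_cont hr_tendsto hr_int hosgood_neg hT hη
    refine ⟨δ, hδ, fun x y hxy ↦ ?_⟩
    rw [dist_eq_norm] at hxy ⊢
    have := h _ _ _ _ (HasDerivWithinAt.comp_time_reversal (hX' x))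
      (HasDerivWithinAt.comp_time_reversal (hX' y)) (fun t _ ↦ by simpa using hδ.le)
      (by simpa only [sub_zero] using hxy.le)
    simpa only [sub_self, hX0] using this
  have hemb : IsUniformEmbedding fun x ↦ X x T := by
    refine Metric.isUniformEmbedding_iff'.2 ⟨fun ε hε ↦ ?_, fun η hη ↦ ?_⟩
    · obtain ⟨δ, hδ, h⟩ := Metric.uniformContinuous_iff.1 hcont ε hε
      exact ⟨δ, hδ, fun {x y} ↦ @h x y⟩
    · obtain ⟨δ, hδ, h⟩ := hinv η hη
      exact ⟨δ, hδ, fun {x y} ↦ h x y⟩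
  have hdense : DenseRange fun x ↦ X x T := by
    refine Metric.denseRange_iff.2 fun y η hη ↦ ?_
    obtain ⟨δ, hδ, h⟩ := osgood_stability hC' hr_cont hr_tendsto hr_int hosgood hT hη
    obtain ⟨R, hR, hbounded⟩ := exists_norm_lt_of_growth (C := C + 1) (by linarith) hr₁_cont
      hr₁_nonneg hr₁_tendsto hr₁_int hT y
    obtain ⟨f, hf, hfc, hfb, hfR⟩ := exists_contDiff_hasCompactSupport_approx hb hR
      (lt_min hδ one_pos) (min_le_right δ 1)
    obtain ⟨u, hu0, hu⟩ := exists_integralCurve_of_hasCompactSupport (h := fun x ↦ -f x) hf.neg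
      hfc.neg y hT
    have huR : ∀ t ∈ Icc 0 T, ‖u t‖ < R := by
      refine hbounded u _ hu (fun t _ ↦ ?_) hu0
      rw [norm_neg]
      have h1 := mul_nonneg (norm_nonneg (u t)) (hr₁_nonneg (‖u t‖ ^ 2) (sq_nonneg _))
      linarith [hfb (u t), hgrowth (u t)]
    refine ⟨u T, ?_⟩
    have := h _ _ _ _ (hX' (u T)) (HasDerivWithinAt.comp_time_reversal hu) (fun t ht ↦ ?_)
      (by simpa [hX0] using hδ.le)
    · rwa [sub_self, hu0, norm_sub_rev, ← dist_eq_norm] at this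
    · have h1 := hfR (u (T - t)) (huR _ ⟨by linarith [ht.2], by linarith [ht.1]⟩).le
      rw [neg_neg, sub_sub_sub_cancel_left, norm_sub_rev]
      exact h1.trans (min_le_left _ _)
  have hsurj : Function.Surjective fun x ↦ X x T := by
    rw [← range_eq_univ, ← hemb.isClosedEmbedding.isClosed_range.closure_eq]
    exact hdense.closure_range
  exact ⟨hemb.isEmbedding.toHomeomorphOfSurjective hsurj, fun _ ↦ rfl⟩
end
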